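/- Let m, n be integers with 1 < m < n and m even. Let G = SL(n, ℝ) and let H = {A ∈ G : A_{ij} = δ_{ij} whenever i > m or j > m} (the standard block-diagonal copy of SL(m, ℝ), consisting of matrices diag(B, I_{n-m}) with B ∈ SL(m,ℝ)). Then there is no discrete subgroup Γ of G acting properly discontinuously and cocompactly on the homogeneous space G/H; that is, SL(n,ℝ)/SL(m,ℝ) admits no compact Clifford–Klein form when m is even. -/

import Mathlib

/-!
The homogeneous space `SL(n,ℝ)/SL(m,ℝ)` admits no compact Clifford–Klein form
when `m` is even, `1 < m < n`.
-/

open Matrix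

set_option maxHeartbeats 1000000
set_option synthInstance.maxHeartbeats 1000000

noncomputable section

/-- The special linear group `SL(n, ℝ)`, realized as the subgroup of `GL(n, ℝ)` of
matrices of determinant `1`. -/
def SLR (n : ℕ) : Subgroup (GL (Fin n) ℝ) where
  carrier := {A | A.val.det = 1}
  one_mem' := by simp
  mul_mem' := by
    intro A B hA hB
    show (A * B).val.det = 1
    rw [Units.val_mul, det_mul, hA, hB, mul_one]
  inv_mem' := by
    intro A hA
    show (A⁻¹).val.det = 1
    have h := congrArg Matrix.det (Units.mul_inv A)
    rw [det_mul, hA, one_mul] at h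
    simpa using h

private def dvec (m n : ℕ) : Fin n → ℝ := fun i => if m ≤ (i : ℕ) then 1 else 0

private theorem blockCond_iff (m n : ℕ) (A : Matrix (Fin n) (Fin n) ℝ) :
    (∀ i j : Fin n, m ≤ (i : ℕ) ∨ m ≤ (j : ℕ) → A i j = if i = j then 1 else 0) ↔
      A * Matrix.diagonal (dvec m n) = Matrix.diagonal (dvec m n) ∧
      Matrix.diagonal (dvec m n) * A = Matrix.diagonal (dvec m n) := by
  constructor
  · intro h
    constructor
    · ext i j
      rw [Matrix.mul_diagonal, Matrix.diagonal_apply]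
      by_cases hj : m ≤ (j : ℕ)
      · rw [h i j (Or.inr hj)]
        by_cases hij : i = j
        · subst hij; simp [dvec, hj]
        · simp [hij]
      · by_cases hij : i = j
        · subst hij; simp [dvec, hj]
        · simp [dvec, hj, hij]
    · ext i j
      rw [Matrix.diagonal_mul, Matrix.diagonal_apply]
      by_cases hi : m ≤ (i : ℕ)
      · rw [h i j (Or.inl hi)]
        by_cases hij : i = j
        · subst hij; simp [dvec, hi]
        · simp [hij]
      · by_cases hij : i = j
        · subst hij; simp [dvec, hi]
        · simp [dvec, hi, hij]
  · rintro ⟨h1, h2⟩ i j hij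
    rcases hij with hi | hj
    · have h := congrFun (congrFun h2 i) j
      rw [Matrix.diagonal_mul, Matrix.diagonal_apply] at h
      by_cases hij' : i = j
      · subst hij'
        simpa [dvec, hi] using h
      · simpa [dvec, hi, hij'] using h
    · have h := congrFun (congrFun h1 i) j
      rw [Matrix.mul_diagonal, Matrix.diagonal_apply] at h
      by_cases hij' : i = j
      · subst hij'
        simpa [dvec, hj] using h
      · simpa [dvec, hj, hij'] using h

/-- The standard block-diagonal copy of `SL(m,ℝ)` inside `SL(n,ℝ)`: the subgroup of matrices
`A` with `A i j = δ i j` whenever `i > m` or `j > m` (in the 0-based indexing of `Fin n`,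
whenever `m ≤ i` or `m ≤ j`), i.e. the matrices `diag(B, I_{n-m})` with `B ∈ SL(m,ℝ)`. -/
def SLRsub (m n : ℕ) : Subgroup ↥(SLR n) where
  carrier := {A | ∀ i j : Fin n, m ≤ (i : ℕ) ∨ m ≤ (j : ℕ) →
      A.val.val i j = if i = j then 1 else 0}
  one_mem' := by
    intro i j _
    exact Matrix.one_apply
  mul_mem' := by
    intro A B hA hB
    rw [Set.mem_setOf_eq, blockCond_iff] at hA hB ⊢
    obtain ⟨hA1, hA2⟩ := hA
    obtain ⟨hB1, hB2⟩ := hB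
    have h : (A * B).val.val = A.val.val * B.val.val := rfl
    constructor
    · rw [h, Matrix.mul_assoc, hB1, hA1]
    · rw [h, ← Matrix.mul_assoc, hA2, hB2]
  inv_mem' := by
    intro A hA
    rw [Set.mem_setOf_eq, blockCond_iff] at hA ⊢
    obtain ⟨h1, h2⟩ := hA
    have hinvA : (A⁻¹).val.val * A.val.val = 1 := by
      have h : (A⁻¹).val = (A.val)⁻¹ := rfl
      rw [h]; exact Units.inv_mul A.val
    have hAinv : A.val.val * (A⁻¹).val.val = 1 := by
      have h : (A⁻¹).val = (A.val)⁻¹ := rfl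
      rw [h]; exact Units.mul_inv A.val
    constructor
    · calc (A⁻¹).val.val * Matrix.diagonal (dvec m n)
          = (A⁻¹).val.val * (A.val.val * Matrix.diagonal (dvec m n)) := by rw [h1]
        _ = ((A⁻¹).val.val * A.val.val) * Matrix.diagonal (dvec m n) := by
            rw [Matrix.mul_assoc]
        _ = Matrix.diagonal (dvec m n) := by rw [hinvA, Matrix.one_mul]
    · calc Matrix.diagonal (dvec m n) * (A⁻¹).val.val
          = (Matrix.diagonal (dvec m n) * A.val.val) * (A⁻¹).val.val := by rw [h2]
        _ = Matrix.diagonal (dvec m n) * (A.val.val * (A⁻¹).val.val) := by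
            rw [Matrix.mul_assoc]
        _ = Matrix.diagonal (dvec m n) := by rw [hAinv, Matrix.mul_one]

/-! ### The entrywise `ℓ¹` norm -/

/-- The sum of the absolute values of the entries of a matrix. -/
def entrySum {n : ℕ} (A : Matrix (Fin n) (Fin n) ℝ) : ℝ := ∑ i, ∑ j, |A i j|

theorem entrySum_nonneg {n : ℕ} (A : Matrix (Fin n) (Fin n) ℝ) : 0 ≤ entrySum A :=
  Finset.sum_nonneg fun _ _ => Finset.sum_nonneg fun _ _ => abs_nonneg _

theorem abs_apply_le_entrySum {n : ℕ} (A : Matrix (Fin n) (Fin n) ℝ) (i j : Fin n) :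
    |A i j| ≤ entrySum A :=
  (Finset.single_le_sum (f := fun j => |A i j|) (fun _ _ => abs_nonneg _)
    (Finset.mem_univ j)).trans
    (Finset.single_le_sum (f := fun i => ∑ j, |A i j|)
      (fun _ _ => Finset.sum_nonneg fun _ _ => abs_nonneg _) (Finset.mem_univ i))

theorem entrySum_le {n : ℕ} {A : Matrix (Fin n) (Fin n) ℝ} {c : ℝ}
    (h : ∀ i j, |A i j| ≤ c) : entrySum A ≤ n * (n * c) := by
  calc entrySum A ≤ ∑ _i : Fin n, ∑ _j : Fin n, c :=
        Finset.sum_le_sum fun i _ => Finset.sum_le_sum fun j _ => h i j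
    _ = n * (n * c) := by simp

theorem entrySum_add_le {n : ℕ} (A B : Matrix (Fin n) (Fin n) ℝ) :
    entrySum (A + B) ≤ entrySum A + entrySum B := by
  simp only [entrySum, ← Finset.sum_add_distrib]
  exact Finset.sum_le_sum fun i _ => Finset.sum_le_sum fun j _ => abs_add_le _ _

theorem entrySum_smul {n : ℕ} (t : ℝ) (A : Matrix (Fin n) (Fin n) ℝ) :
    entrySum (t • A) = |t| * entrySum A := by
  simp [entrySum, abs_mul, Finset.mul_sum]

theorem entrySum_sub_le {n : ℕ} (A B : Matrix (Fin n) (Fin n) ℝ) :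
    entrySum (A - B) ≤ entrySum A + entrySum B := by
  have h := entrySum_add_le A ((-1 : ℝ) • B)
  rw [entrySum_smul] at h
  simpa [sub_eq_add_neg] using h

theorem entrySum_transpose {n : ℕ} (A : Matrix (Fin n) (Fin n) ℝ) :
    entrySum Aᵀ = entrySum A := by
  simp only [entrySum, transpose_apply]
  exact Finset.sum_comm

theorem entrySum_mul_le {n : ℕ} (A B : Matrix (Fin n) (Fin n) ℝ) :
    entrySum (A * B) ≤ entrySum A * entrySum B := by
  have hrow : ∀ k, ∑ j, |B k j| ≤ entrySum B := fun k =>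
    Finset.single_le_sum (f := fun i => ∑ j, |B i j|)
      (fun _ _ => Finset.sum_nonneg fun _ _ => abs_nonneg _) (Finset.mem_univ k)
  calc entrySum (A * B) ≤ ∑ i, ∑ j, ∑ k, |A i k| * |B k j| := by
        refine Finset.sum_le_sum fun i _ => Finset.sum_le_sum fun j _ => ?_
        rw [Matrix.mul_apply]
        refine (Finset.abs_sum_le_sum_abs _ _).trans_eq ?_
        simp only [abs_mul]
    _ = ∑ i, ∑ k, |A i k| * ∑ j, |B k j| := by
        refine Finset.sum_congr rfl fun i _ => ?_
        rw [Finset.sum_comm]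
        simp only [Finset.mul_sum]
    _ ≤ ∑ i, ∑ k, |A i k| * entrySum B :=
        Finset.sum_le_sum fun i _ => Finset.sum_le_sum fun k _ =>
          mul_le_mul_of_nonneg_left (hrow k) (abs_nonneg _)
    _ = entrySum A * entrySum B := by simp only [entrySum, Finset.sum_mul]

theorem entrySum_mul_le_of_le {n : ℕ} {A B : Matrix (Fin n) (Fin n) ℝ} {a b : ℝ}
    (hA : entrySum A ≤ a) (hB : entrySum B ≤ b) : entrySum (A * B) ≤ a * b :=
  (entrySum_mul_le A B).trans
    (mul_le_mul hA hB (entrySum_nonneg _) ((entrySum_nonneg _).trans hA))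

theorem continuous_entrySum {n : ℕ} :
    Continuous (entrySum : Matrix (Fin n) (Fin n) ℝ → ℝ) := by
  unfold entrySum
  fun_prop

theorem entrySum_pos {n : ℕ} {A : Matrix (Fin n) (Fin n) ℝ} (hA : A ≠ 0) :
    0 < entrySum A := by
  refine lt_of_le_of_ne (entrySum_nonneg A) fun h => hA ?_
  ext i j
  have := abs_apply_le_entrySum A i j
  rw [← h] at this
  simpa using abs_nonpos_iff.mp this

theorem exists_lt_entrySum_add_smul {n : ℕ} (A : Matrix (Fin n) (Fin n) ℝ)
    {B : Matrix (Fin n) (Fin n) ℝ} (hB : B ≠ 0) (c : ℝ) :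
    ∃ t : ℝ, 0 < t ∧ c < entrySum (A + t • B) := by
  have hpos := entrySum_pos hB
  have hA := entrySum_nonneg A
  refine ⟨(|c| + entrySum A + 1) / entrySum B, by positivity, ?_⟩
  set t := (|c| + entrySum A + 1) / entrySum B with ht
  have ht0 : 0 ≤ t := by positivity
  have h := entrySum_sub_le (A + t • B) A
  rw [add_sub_cancel_left, entrySum_smul, abs_of_nonneg ht0, ht,
    div_mul_cancel₀ _ hpos.ne'] at h
  linarith [le_abs_self c]

/-! ### Sign constancy -/

theorem mul_pos_trans {a b c : ℝ} (hab : 0 < a * b) (hbc : 0 < b * c) : 0 < a * c := by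
  have hb : b ≠ 0 := fun h => by simp [h] at hab
  have h : 0 < b ^ 2 * (a * c) := by
    calc 0 < (a * b) * (b * c) := mul_pos hab hbc
      _ = b ^ 2 * (a * c) := by ring
  exact pos_of_mul_pos_right h (by positivity)

theorem mul_pos_of_continuousOn_Icc {f : ℝ → ℝ} (hf : ContinuousOn f (Set.Icc 0 1))
    (h0 : ∀ t ∈ Set.Icc (0 : ℝ) 1, f t ≠ 0) : 0 < f 0 * f 1 := by
  by_contra hneg
  have h0' := h0 0 (by simp)
  have h1' := h0 1 (by simp)
  rcases lt_or_gt_of_ne h0' with h | h <;> rcases lt_or_gt_of_ne h1' with h' | h'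
  · exact hneg (mul_pos_of_neg_of_neg h h')
  · obtain ⟨t, ht, hft⟩ := intermediate_value_Icc zero_le_one hf ⟨h.le, h'.le⟩
    exact h0 t ht hft
  · obtain ⟨t, ht, hft⟩ := intermediate_value_Icc' zero_le_one hf ⟨h'.le, h.le⟩
    exact h0 t ht hft
  · exact hneg (mul_pos h h')

/-- Two vectors with nonvanishing Gram determinant admit a linear form equal to `1` on both. -/
theorem exists_dotProduct_eq_one {n : ℕ} (D : Submodule ℝ (Fin n → ℝ)) {y z : Fin n → ℝ}
    (hy : y ∈ D) (hz : z ∈ D) (h : (y ⬝ᵥ y) * (z ⬝ᵥ z) - (y ⬝ᵥ z) ^ 2 ≠ 0) :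
    ∃ η ∈ D, η ⬝ᵥ y = 1 ∧ η ⬝ᵥ z = 1 := by
  set Δ := (y ⬝ᵥ y) * (z ⬝ᵥ z) - (y ⬝ᵥ z) ^ 2 with hΔ
  refine ⟨((z ⬝ᵥ z - y ⬝ᵥ z) / Δ) • y + ((y ⬝ᵥ y - y ⬝ᵥ z) / Δ) • z,
    D.add_mem (D.smul_mem _ hy) (D.smul_mem _ hz), ?_, ?_⟩
  · rw [add_dotProduct, smul_dotProduct, smul_dotProduct, dotProduct_comm z y]
    simp only [smul_eq_mul]
    field_simp
    rw [hΔ]; ring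
  · rw [add_dotProduct, smul_dotProduct, smul_dotProduct]
    simp only [smul_eq_mul]
    field_simp
    rw [hΔ]; ring

theorem dotProduct_self_pos {n : ℕ} {v : Fin n → ℝ} (hv : v ≠ 0) : 0 < v ⬝ᵥ v :=
  lt_of_le_of_ne (Finset.sum_nonneg fun i _ => mul_self_nonneg (v i))
    fun h => hv (dotProduct_self_eq_zero.mp h.symm)

/-- Let `D` be a space of vectors in which any two vectors have a common nonzero orthogonal
vector. A function on the pairs `(y, η)` with `η ⬝ᵥ y = 1` whose sign does not change in
`η` when `P y` holds, nor in `y` when `S η` holds, has constant sign where `P y ∨ S η`,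
provided that every line meets both `P` and `S`. -/
theorem mul_pos_of_sign_const {n : ℕ} (D : Submodule ℝ (Fin n → ℝ))
    (hD : ∀ y z : Fin n → ℝ, ∃ ζ ∈ D, ζ ≠ 0 ∧ ζ ⬝ᵥ y = 0 ∧ ζ ⬝ᵥ z = 0)
    (P S : (Fin n → ℝ) → Prop)
    (hP : ∀ y ζ : Fin n → ℝ, ζ ≠ 0 → ∃ t : ℝ, 0 < t ∧ P (y + t • ζ))
    (hS : ∀ y ζ : Fin n → ℝ, ζ ≠ 0 → ∃ t : ℝ, 0 < t ∧ S (y + t • ζ))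
    (g : (Fin n → ℝ) → (Fin n → ℝ) → ℝ)
    (hgP : ∀ y ∈ D, ∀ η ∈ D, ∀ η' ∈ D, η ⬝ᵥ y = 1 → η' ⬝ᵥ y = 1 → P y →
      0 < g y η * g y η')
    (hgS : ∀ η ∈ D, ∀ y ∈ D, ∀ y' ∈ D, η ⬝ᵥ y = 1 → η ⬝ᵥ y' = 1 → S η →
      0 < g y η * g y' η)
    {y η y' η' : Fin n → ℝ} (hy : y ∈ D) (hη : η ∈ D) (hy' : y' ∈ D) (hη' : η' ∈ D)
    (h : η ⬝ᵥ y = 1) (h' : η' ⬝ᵥ y' = 1) (hPS : P y ∨ S η) (hPS' : P y' ∨ S η') :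
    0 < g y η * g y' η' := by
  have key : ∀ y ∈ D, ∀ η ∈ D, ∀ y' ∈ D, ∀ η' ∈ D, η ⬝ᵥ y = 1 → η' ⬝ᵥ y' = 1 →
      P y → P y' → (y ⬝ᵥ y) * (y' ⬝ᵥ y') - (y ⬝ᵥ y') ^ 2 ≠ 0 →
      0 < g y η * g y' η' := by
    intro y hy η hη y' hy' η' hη' h h' hPy hPy' hΔ
    obtain ⟨θ, hθ, hθy, hθy'⟩ := exists_dotProduct_eq_one D hy hy' hΔ
    obtain ⟨ζ, hζ, hζ0, hζy, hζy'⟩ := hD y y'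
    obtain ⟨t, -, ht⟩ := hS θ ζ hζ0
    have hmem : θ + t • ζ ∈ D := D.add_mem hθ (D.smul_mem _ hζ)
    have e1 : (θ + t • ζ) ⬝ᵥ y = 1 := by simp [add_dotProduct, hθy, hζy]
    have e2 : (θ + t • ζ) ⬝ᵥ y' = 1 := by simp [add_dotProduct, hθy', hζy']
    exact mul_pos_trans (hgP y hy η hη _ hmem h e1 hPy)
      (mul_pos_trans (hgS _ hmem y hy y' hy' e1 e2 ht) (hgP y' hy' _ hmem η' hη' e2 h' hPy'))
  have key' : ∀ y ∈ D, ∀ η ∈ D, ∀ y' ∈ D, ∀ η' ∈ D, η ⬝ᵥ y = 1 → η' ⬝ᵥ y' = 1 →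
      P y → P y' → 0 < g y η * g y' η' := by
    intro y hy η hη y' hy' η' hη' h h' hPy hPy'
    obtain ⟨ζ, hζ, hζ0, hζy, hζy'⟩ := hD y y'
    obtain ⟨t, ht0, ht⟩ := hP y ζ hζ0
    have hmem : y + t • ζ ∈ D := D.add_mem hy (D.smul_mem _ hζ)
    have hy0 : y ≠ 0 := fun h0 => by simp [h0] at h
    have hy0' : y' ≠ 0 := fun h0 => by simp [h0] at h'
    have p := dotProduct_self_pos hy0
    have p' := dotProduct_self_pos hy0'
    have pζ := dotProduct_self_pos hζ0
    have e1 : (y + t • ζ) ⬝ᵥ (y + t • ζ) = y ⬝ᵥ y + t ^ 2 * (ζ ⬝ᵥ ζ) := by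
      simp only [add_dotProduct, dotProduct_add, smul_dotProduct, dotProduct_smul,
        hζy, dotProduct_comm y ζ, smul_eq_mul]
      ring
    have e2 : y ⬝ᵥ (y + t • ζ) = y ⬝ᵥ y := by
      simp [dotProduct_add, dotProduct_comm y ζ, hζy]
    have e3 : (y + t • ζ) ⬝ᵥ y' = y ⬝ᵥ y' := by
      simp [add_dotProduct, hζy']
    have cs : (y ⬝ᵥ y') ^ 2 ≤ (y ⬝ᵥ y) * (y' ⬝ᵥ y') := by
      simpa [dotProduct, pow_two] using Finset.sum_mul_sq_le_sq_mul_sq Finset.univ y y'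
    have hΔ : (y ⬝ᵥ y) * ((y + t • ζ) ⬝ᵥ (y + t • ζ)) - (y ⬝ᵥ (y + t • ζ)) ^ 2 ≠ 0 := by
      rw [e1, e2]
      have : 0 < (y ⬝ᵥ y) * (t ^ 2 * (ζ ⬝ᵥ ζ)) := by positivity
      apply ne_of_gt
      linarith
    have hΔ' : ((y + t • ζ) ⬝ᵥ (y + t • ζ)) * (y' ⬝ᵥ y') - ((y + t • ζ) ⬝ᵥ y') ^ 2 ≠ 0 := by
      rw [e1, e3]
      have : 0 < (y' ⬝ᵥ y') * (t ^ 2 * (ζ ⬝ᵥ ζ)) := by positivity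
      apply ne_of_gt
      linarith
    obtain ⟨θ, hθ, hθy, hθy'⟩ := exists_dotProduct_eq_one D hy hmem hΔ
    exact mul_pos_trans (key y hy η hη _ hmem θ hθ h hθy' hPy ht hΔ)
      (key _ hmem θ hθ y' hy' η' hη' hθy' h' ht hPy' hΔ')
  have large : ∀ y ∈ D, ∀ η ∈ D, η ⬝ᵥ y = 1 → P y ∨ S η →
      ∃ y₁ ∈ D, ∃ η₁ ∈ D, η₁ ⬝ᵥ y₁ = 1 ∧ P y₁ ∧ 0 < g y η * g y₁ η₁ := by
    intro y hy η hη h hPS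
    rcases hPS with hPy | hSη
    · exact ⟨y, hy, η, hη, h, hPy, hgP y hy η hη η hη h h hPy⟩
    · obtain ⟨ζ, hζ, hζ0, hζη, -⟩ := hD η η
      obtain ⟨t, -, ht⟩ := hP y ζ hζ0
      have hmem : y + t • ζ ∈ D := D.add_mem hy (D.smul_mem _ hζ)
      have e : η ⬝ᵥ (y + t • ζ) = 1 := by
        simp [dotProduct_add, dotProduct_comm η ζ, hζη, h]
      exact ⟨_, hmem, η, hη, e, ht, hgS η hη y hy _ hmem h e hSη⟩
  obtain ⟨y₁, hy₁, η₁, hη₁, h₁, hP₁, hg₁⟩ := large y hy η hη h hPS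
  obtain ⟨y₂, hy₂, η₂, hη₂, h₂, hP₂, hg₂⟩ := large y' hy' η' hη' h' hPS'
  exact mul_pos_trans hg₁ (mul_pos_trans (key' y₁ hy₁ η₁ hη₁ y₂ hy₂ η₂ hη₂ h₁ h₂ hP₁ hP₂)
    (by rwa [mul_comm]))


/-! ### Frame pairs and the actions on them -/

section FramePairs

variable {n : ℕ} {Γ : Type*} [Group Γ]

/-- The pairs `(g * Q, Q * g⁻¹)`, characterized by matrix identities. -/
structure IsFramePair (Q : Matrix (Fin n) (Fin n) ℝ)
    (x : Matrix (Fin n) (Fin n) ℝ × Matrix (Fin n) (Fin n) ℝ) : Prop where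
  fst_mul : x.1 * Q = x.1
  mul_snd : Q * x.2 = x.2
  snd_mul_fst : x.2 * x.1 = Q

/-- The size of a pair of matrices. -/
def pairSize (x : Matrix (Fin n) (Fin n) ℝ × Matrix (Fin n) (Fin n) ℝ) : ℝ :=
  entrySum x.1 + entrySum x.2

/-- The translate of a pair of matrices by `ρ γ⁻¹`. -/
def invTranslate (ρ : Γ →* Matrix (Fin n) (Fin n) ℝ) (γ : Γ)
    (x : Matrix (Fin n) (Fin n) ℝ × Matrix (Fin n) (Fin n) ℝ) :
    Matrix (Fin n) (Fin n) ℝ × Matrix (Fin n) (Fin n) ℝ :=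
  (ρ γ⁻¹ * x.1, x.2 * ρ γ)

/-- A linear representation whose action on frame pairs is proper and cocompact. -/
structure FrameAction (Γ : Type*) [Group Γ] (Q : Matrix (Fin n) (Fin n) ℝ) where
  /-- the representation -/
  rep : Γ →* Matrix (Fin n) (Fin n) ℝ
  /-- the size of a fundamental domain -/
  radius : ℝ
  finite_return : ∀ S : ℝ, {γ : Γ | ∃ x, IsFramePair Q x ∧ pairSize x ≤ S ∧
    pairSize (invTranslate rep γ x) ≤ S}.Finite
  cover : ∀ x, IsFramePair Q x → ∃ γ, pairSize (invTranslate rep γ x) ≤ radius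

theorem pairSize_nonneg (x : Matrix (Fin n) (Fin n) ℝ × Matrix (Fin n) (Fin n) ℝ) :
    0 ≤ pairSize x := add_nonneg (entrySum_nonneg _) (entrySum_nonneg _)

theorem entrySum_fst_le (x : Matrix (Fin n) (Fin n) ℝ × Matrix (Fin n) (Fin n) ℝ) :
    entrySum x.1 ≤ pairSize x := le_add_of_nonneg_right (entrySum_nonneg _)

theorem entrySum_snd_le (x : Matrix (Fin n) (Fin n) ℝ × Matrix (Fin n) (Fin n) ℝ) :
    entrySum x.2 ≤ pairSize x := le_add_of_nonneg_left (entrySum_nonneg _)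

theorem rep_mul_inv (ρ : Γ →* Matrix (Fin n) (Fin n) ℝ) (γ : Γ) : ρ γ * ρ γ⁻¹ = 1 := by
  rw [← map_mul, mul_inv_cancel, map_one]

theorem rep_inv_mul (ρ : Γ →* Matrix (Fin n) (Fin n) ℝ) (γ : Γ) : ρ γ⁻¹ * ρ γ = 1 := by
  rw [← map_mul, inv_mul_cancel, map_one]

theorem invTranslate_one (ρ : Γ →* Matrix (Fin n) (Fin n) ℝ)
    (x : Matrix (Fin n) (Fin n) ℝ × Matrix (Fin n) (Fin n) ℝ) : invTranslate ρ 1 x = x := by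
  simp [invTranslate]

theorem invTranslate_invTranslate (ρ : Γ →* Matrix (Fin n) (Fin n) ℝ) (γ δ : Γ)
    (x : Matrix (Fin n) (Fin n) ℝ × Matrix (Fin n) (Fin n) ℝ) :
    invTranslate ρ δ (invTranslate ρ γ x) = invTranslate ρ (γ * δ) x := by
  simp [_root_.invTranslate, Matrix.mul_assoc]

theorem IsFramePair.invTranslate {Q : Matrix (Fin n) (Fin n) ℝ}
    {x : Matrix (Fin n) (Fin n) ℝ × Matrix (Fin n) (Fin n) ℝ} (hx : IsFramePair Q x)
    (ρ : Γ →* Matrix (Fin n) (Fin n) ℝ) (γ : Γ) : IsFramePair Q (invTranslate ρ γ x) where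
  fst_mul := by simp [_root_.invTranslate, Matrix.mul_assoc, hx.fst_mul]
  mul_snd := by simp [_root_.invTranslate, ← Matrix.mul_assoc, hx.mul_snd]
  snd_mul_fst := by
    calc x.2 * ρ γ * (ρ γ⁻¹ * x.1) = x.2 * (ρ γ * ρ γ⁻¹) * x.1 := by
          simp only [Matrix.mul_assoc]
      _ = Q := by rw [rep_mul_inv, Matrix.mul_one, hx.snd_mul_fst]

theorem continuous_pairSize :
    Continuous (pairSize : Matrix (Fin n) (Fin n) ℝ × Matrix (Fin n) (Fin n) ℝ → ℝ) :=
  (continuous_entrySum.comp continuous_fst).add (continuous_entrySum.comp continuous_snd)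

theorem continuous_invTranslate (ρ : Γ →* Matrix (Fin n) (Fin n) ℝ) (γ : Γ) :
    Continuous (invTranslate ρ γ) := by
  unfold invTranslate
  fun_prop

namespace FrameAction

variable {Q : Matrix (Fin n) (Fin n) ℝ} (F : FrameAction Γ Q)

theorem exists_finset (S : ℝ) : ∃ Φ : Finset Γ, ∀ γ x, IsFramePair Q x → pairSize x ≤ S →
    pairSize (invTranslate F.rep γ x) ≤ S → γ ∈ Φ :=
  ⟨(F.finite_return S).toFinset, fun γ x hx h h' => by simpa using ⟨x.1, x.2, hx, h, h'⟩⟩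

/-- If `γ` and `γ'` move the same frame pair to bounded size, then a pair of bounded size
after translation by `γ'` has bounded size after translation by `γ`. -/
theorem exists_transfer_bound (S : ℝ) : ∃ S' : ℝ, ∀ γ γ' p x, IsFramePair Q p →
    pairSize (invTranslate F.rep γ p) ≤ S → pairSize (invTranslate F.rep γ' p) ≤ S →
    pairSize (invTranslate F.rep γ' x) ≤ S → pairSize (invTranslate F.rep γ x) ≤ S' := by
  obtain ⟨Φ, hΦ⟩ := F.exists_finset S
  let k : Γ → ℝ := fun δ => entrySum (F.rep δ) + entrySum (F.rep δ⁻¹)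
  have hk0 : ∀ δ, 0 ≤ k δ := fun δ => add_nonneg (entrySum_nonneg _) (entrySum_nonneg _)
  refine ⟨(∑ δ ∈ Φ, k δ) * S, fun γ γ' p x hp h h' hx => ?_⟩
  have hmem : γ⁻¹ * γ' ∈ Φ := by
    refine hΦ _ _ (hp.invTranslate F.rep γ) h ?_
    rwa [invTranslate_invTranslate, mul_inv_cancel_left]
  have hk : k (γ⁻¹ * γ') ≤ ∑ δ ∈ Φ, k δ :=
    Finset.single_le_sum (f := k) (fun δ _ => hk0 δ) hmem
  have e : invTranslate F.rep γ x =
      invTranslate F.rep (γ⁻¹ * γ')⁻¹ (invTranslate F.rep γ' x) := by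
    rw [invTranslate_invTranslate]
    simp
  rw [e]
  set z := invTranslate F.rep γ' x
  set δ := γ⁻¹ * γ'
  have h1 : entrySum (F.rep δ) ≤ k δ := le_add_of_nonneg_right (entrySum_nonneg _)
  have h2 : entrySum (F.rep δ⁻¹) ≤ k δ := le_add_of_nonneg_left (entrySum_nonneg _)
  calc pairSize (invTranslate F.rep δ⁻¹ z)
      ≤ k δ * entrySum z.1 + entrySum z.2 * k δ := by
        refine add_le_add ?_ (entrySum_mul_le_of_le le_rfl h2)
        simpa [invTranslate] using entrySum_mul_le_of_le h1 (le_refl (entrySum z.1))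
    _ = k δ * pairSize z := by rw [pairSize]; ring
    _ ≤ _ := mul_le_mul hk hx (pairSize_nonneg _) ((hk0 _).trans hk)

/-- The bump function supported on the translates of a fundamental domain. -/
def weight (γ : Γ) (x : Matrix (Fin n) (Fin n) ℝ × Matrix (Fin n) (Fin n) ℝ) : ℝ :=
  max 0 (F.radius + 1 - pairSize (invTranslate F.rep γ x))

/-- The contribution of a group element to `FrameAction.metric`. -/
def bump (γ : Γ) (x : Matrix (Fin n) (Fin n) ℝ × Matrix (Fin n) (Fin n) ℝ) :
    Matrix (Fin n) (Fin n) ℝ :=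
  F.weight γ x • ((F.rep γ⁻¹ * (1 - x.1 * x.2))ᵀ * (F.rep γ⁻¹ * (1 - x.1 * x.2)))

/-- An equivariant family of inner products on `ℝⁿ` parametrized by frame pairs. -/
def metric (x : Matrix (Fin n) (Fin n) ℝ × Matrix (Fin n) (Fin n) ℝ) :
    Matrix (Fin n) (Fin n) ℝ :=
  x.2ᵀ * x.2 + ∑ᶠ γ, F.bump γ x

theorem weight_nonneg (γ : Γ) (x : Matrix (Fin n) (Fin n) ℝ × Matrix (Fin n) (Fin n) ℝ) :
    0 ≤ F.weight γ x := le_max_left _ _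

theorem one_le_weight {γ : Γ} {x : Matrix (Fin n) (Fin n) ℝ × Matrix (Fin n) (Fin n) ℝ}
    (h : pairSize (invTranslate F.rep γ x) ≤ F.radius) : 1 ≤ F.weight γ x :=
  le_max_of_le_right (by linarith)

theorem pairSize_le_of_bump_ne_zero {γ : Γ}
    {x : Matrix (Fin n) (Fin n) ℝ × Matrix (Fin n) (Fin n) ℝ} (h : F.bump γ x ≠ 0) :
    pairSize (invTranslate F.rep γ x) ≤ F.radius + 1 := by
  by_contra hlt
  refine h ?_
  rw [bump, weight, max_eq_left (by linarith), zero_smul]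

theorem exists_metric_eq (S : ℝ) : ∃ Φ : Finset Γ,
    (∀ x, IsFramePair Q x → pairSize x ≤ S → Function.support (fun γ => F.bump γ x) ⊆ Φ) ∧
    ∀ x, IsFramePair Q x → pairSize x ≤ S →
      F.metric x = x.2ᵀ * x.2 + ∑ γ ∈ Φ, F.bump γ x := by
  obtain ⟨Φ, hΦ⟩ := F.exists_finset (max S (F.radius + 1))
  have key : ∀ x, IsFramePair Q x → pairSize x ≤ S →
      Function.support (fun γ => F.bump γ x) ⊆ Φ := fun x hx h γ hγ =>
    hΦ γ x hx (h.trans (le_max_left _ _))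
      ((F.pairSize_le_of_bump_ne_zero hγ).trans (le_max_right _ _))
  exact ⟨Φ, key, fun x hx h => by
    rw [metric, finsum_eq_sum_of_support_subset _ (key x hx h)]⟩

theorem bump_invTranslate (γ δ : Γ) (x : Matrix (Fin n) (Fin n) ℝ × Matrix (Fin n) (Fin n) ℝ) :
    F.bump δ (invTranslate F.rep γ x) =
      (F.rep γ)ᵀ * F.bump (γ * δ) x * F.rep γ := by
  have e : F.rep δ⁻¹ * (1 - F.rep γ⁻¹ * x.1 * (x.2 * F.rep γ)) =
      F.rep (γ * δ)⁻¹ * (1 - x.1 * x.2) * F.rep γ := by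
    rw [_root_.mul_inv_rev, map_mul]
    have : (1 : Matrix (Fin n) (Fin n) ℝ) - F.rep γ⁻¹ * x.1 * (x.2 * F.rep γ) =
        F.rep γ⁻¹ * (1 - x.1 * x.2) * F.rep γ := by
      rw [Matrix.mul_sub, Matrix.sub_mul, Matrix.mul_one, rep_inv_mul]
      simp only [Matrix.mul_assoc]
    rw [this]
    simp only [Matrix.mul_assoc]
  rw [bump, bump, weight, weight, invTranslate_invTranslate]
  simp only [invTranslate]
  rw [e, transpose_mul _ (F.rep γ)]
  simp only [Matrix.mul_smul, Matrix.smul_mul, Matrix.mul_assoc]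

theorem metric_invTranslate {x : Matrix (Fin n) (Fin n) ℝ × Matrix (Fin n) (Fin n) ℝ}
    (hx : IsFramePair Q x) (γ : Γ) :
    F.metric (invTranslate F.rep γ x) = (F.rep γ)ᵀ * F.metric x * F.rep γ := by
  obtain ⟨Φ, hΦ, -⟩ := F.exists_metric_eq (pairSize x)
  have hfin : (Function.support fun δ => F.bump δ x).Finite :=
    Φ.finite_toSet.subset (hΦ x hx le_rfl)
  let L : Matrix (Fin n) (Fin n) ℝ →+ Matrix (Fin n) (Fin n) ℝ :=
    (AddMonoidHom.mulRight (F.rep γ)).comp (AddMonoidHom.mulLeft (F.rep γ)ᵀ)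
  have hsum : ∑ᶠ δ, F.bump δ (invTranslate F.rep γ x) =
      (F.rep γ)ᵀ * (∑ᶠ δ, F.bump δ x) * F.rep γ := by
    calc ∑ᶠ δ, F.bump δ (invTranslate F.rep γ x) = ∑ᶠ δ, L (F.bump (γ * δ) x) :=
          finsum_congr fun δ => F.bump_invTranslate γ δ x
      _ = ∑ᶠ δ, L (F.bump δ x) :=
          finsum_comp_equiv (Equiv.mulLeft γ) (f := fun δ => L (F.bump δ x))
      _ = L (∑ᶠ δ, F.bump δ x) := (AddMonoidHom.map_finsum L hfin).symm
      _ = _ := rfl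
  rw [metric, hsum, metric, Matrix.mul_add, Matrix.add_mul]
  congr 1
  simp only [invTranslate, transpose_mul, Matrix.mul_assoc]

theorem transpose_metric {x : Matrix (Fin n) (Fin n) ℝ × Matrix (Fin n) (Fin n) ℝ}
    (hx : IsFramePair Q x) : (F.metric x)ᵀ = F.metric x := by
  obtain ⟨Φ, -, h⟩ := F.exists_metric_eq (pairSize x)
  rw [h x hx le_rfl]
  simp [bump, transpose_sum, transpose_mul, Matrix.mul_assoc]

theorem dotProduct_transpose_mul_self_mulVec (K : Matrix (Fin n) (Fin n) ℝ) (a : Fin n → ℝ) :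
    a ⬝ᵥ (Kᵀ * K) *ᵥ a = (K *ᵥ a) ⬝ᵥ (K *ᵥ a) := by
  rw [← mulVec_mulVec, dotProduct_mulVec, vecMul_transpose]

theorem dotProduct_self_nonneg (v : Fin n → ℝ) : 0 ≤ v ⬝ᵥ v :=
  Finset.sum_nonneg fun i _ => mul_self_nonneg (v i)

theorem dotProduct_bump (γ : Γ) (x : Matrix (Fin n) (Fin n) ℝ × Matrix (Fin n) (Fin n) ℝ)
    (a : Fin n → ℝ) : a ⬝ᵥ F.bump γ x *ᵥ a = F.weight γ x *
      (((F.rep γ⁻¹ * (1 - x.1 * x.2)) *ᵥ a) ⬝ᵥ ((F.rep γ⁻¹ * (1 - x.1 * x.2)) *ᵥ a)) := by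
  rw [bump, smul_mulVec, dotProduct_smul, dotProduct_transpose_mul_self_mulVec, smul_eq_mul]

theorem dotProduct_bump_nonneg (γ : Γ)
    (x : Matrix (Fin n) (Fin n) ℝ × Matrix (Fin n) (Fin n) ℝ)
    (a : Fin n → ℝ) : 0 ≤ a ⬝ᵥ F.bump γ x *ᵥ a := by
  rw [dotProduct_bump]
  exact mul_nonneg (F.weight_nonneg _ _) (dotProduct_self_nonneg _)

theorem le_dotProduct_metric {x : Matrix (Fin n) (Fin n) ℝ × Matrix (Fin n) (Fin n) ℝ}
    (hx : IsFramePair Q x) (γ : Γ) (a : Fin n → ℝ) :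
    (x.2 *ᵥ a) ⬝ᵥ (x.2 *ᵥ a) + a ⬝ᵥ F.bump γ x *ᵥ a ≤ a ⬝ᵥ F.metric x *ᵥ a := by
  classical
  obtain ⟨Φ, hsup, h⟩ := F.exists_metric_eq (pairSize x)
  rw [h x hx le_rfl, add_mulVec, dotProduct_add, dotProduct_transpose_mul_self_mulVec,
    sum_mulVec, dotProduct_sum]
  refine add_le_add le_rfl ?_
  by_cases hγ : γ ∈ Φ
  · exact Finset.single_le_sum (f := fun γ => a ⬝ᵥ F.bump γ x *ᵥ a)
      (fun δ _ => F.dotProduct_bump_nonneg δ x a) hγ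
  · have : F.bump γ x = 0 := by
      by_contra h0
      exact hγ (hsup x hx le_rfl h0)
    rw [this]
    simpa using Finset.sum_nonneg fun δ _ => F.dotProduct_bump_nonneg δ x a

theorem eq_zero_of_mulVec_eq_zero {x : Matrix (Fin n) (Fin n) ℝ × Matrix (Fin n) (Fin n) ℝ}
    {γ : Γ} {a : Fin n → ℝ} (h : x.2 *ᵥ a = 0)
    (h' : (F.rep γ⁻¹ * (1 - x.1 * x.2)) *ᵥ a = 0) : a = 0 := by
  have h1 : (1 - x.1 * x.2) *ᵥ a = a := by
    rw [sub_mulVec, one_mulVec, ← mulVec_mulVec, h, mulVec_zero, sub_zero]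
  rw [← mulVec_mulVec, h1] at h'
  rw [← one_mulVec a, ← rep_mul_inv F.rep γ, ← mulVec_mulVec, h', mulVec_zero]

theorem dotProduct_metric_pos {x : Matrix (Fin n) (Fin n) ℝ × Matrix (Fin n) (Fin n) ℝ}
    (hx : IsFramePair Q x) {a : Fin n → ℝ} (ha : a ≠ 0) : 0 < a ⬝ᵥ F.metric x *ᵥ a := by
  obtain ⟨γ, hγ⟩ := F.cover x hx
  have hw := F.one_le_weight hγ
  have hle := F.le_dotProduct_metric hx γ a
  rw [dotProduct_bump] at hle
  refine lt_of_lt_of_le ?_ hle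
  by_cases h : x.2 *ᵥ a = 0
  · have h' : (F.rep γ⁻¹ * (1 - x.1 * x.2)) *ᵥ a ≠ 0 := fun h' =>
      ha (F.eq_zero_of_mulVec_eq_zero h h')
    have := dotProduct_self_pos h'
    have := dotProduct_self_nonneg (x.2 *ᵥ a)
    positivity
  · have := dotProduct_self_pos h
    have := dotProduct_self_nonneg ((F.rep γ⁻¹ * (1 - x.1 * x.2)) *ᵥ a)
    positivity

theorem abs_le_one_of_dotProduct_self_le_one {v : Fin n → ℝ} (h : v ⬝ᵥ v ≤ 1) (i : Fin n) :
    |v i| ≤ 1 := by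
  have : v i * v i ≤ v ⬝ᵥ v :=
    Finset.single_le_sum (f := fun i => v i * v i) (fun i _ => mul_self_nonneg _)
      (Finset.mem_univ i)
  exact abs_le_one_iff_mul_self_le_one.mpr (this.trans h)

theorem abs_mulVec_le (A : Matrix (Fin n) (Fin n) ℝ) {v : Fin n → ℝ} {c : ℝ}
    (hv : ∀ i, |v i| ≤ c) (i : Fin n) : |(A *ᵥ v) i| ≤ entrySum A * c := by
  calc |(A *ᵥ v) i| ≤ ∑ j, |A i j| * |v j| := by
        rw [mulVec, dotProduct]
        refine (Finset.abs_sum_le_sum_abs _ _).trans_eq ?_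
        simp only [abs_mul]
    _ ≤ ∑ j, |A i j| * c :=
        Finset.sum_le_sum fun j _ => mul_le_mul_of_nonneg_left (hv j) (abs_nonneg _)
    _ = (∑ j, |A i j|) * c := (Finset.sum_mul _ _ _).symm
    _ ≤ entrySum A * c := by
        refine mul_le_mul_of_nonneg_right ?_ ((abs_nonneg _).trans (hv i))
        exact Finset.single_le_sum (f := fun i => ∑ j, |A i j|)
          (fun _ _ => Finset.sum_nonneg fun _ _ => abs_nonneg _) (Finset.mem_univ i)

theorem exists_entrySum_metric_le (S : ℝ) : ∃ C : ℝ, ∀ x, IsFramePair Q x → pairSize x ≤ S →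
    entrySum (F.metric x) ≤ C := by
  obtain ⟨Φ, -, h⟩ := F.exists_metric_eq S
  let k : Γ → ℝ := fun γ => entrySum (F.rep γ⁻¹) *
    (entrySum (1 : Matrix (Fin n) (Fin n) ℝ) + S * S)
  refine ⟨S * S + ∑ γ ∈ Φ, (|F.radius + 1| * (k γ * k γ)), fun x hx hS => ?_⟩
  have h1 := (entrySum_fst_le x).trans hS
  have h2 := (entrySum_snd_le x).trans hS
  have hsum : ∀ Ψ : Finset Γ, entrySum (∑ γ ∈ Ψ, F.bump γ x) ≤
      ∑ γ ∈ Ψ, (|F.radius + 1| * (k γ * k γ)) := by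
    classical
    intro Ψ
    induction Ψ using Finset.induction_on with
    | empty => simp [entrySum]
    | insert γ Ψ hγ ih =>
      rw [Finset.sum_insert hγ, Finset.sum_insert hγ]
      refine (entrySum_add_le _ _).trans (add_le_add ?_ ih)
      rw [bump, entrySum_smul, abs_of_nonneg (F.weight_nonneg _ _)]
      have hw : F.weight γ x ≤ |F.radius + 1| := max_le (abs_nonneg _)
        (by linarith [pairSize_nonneg (invTranslate F.rep γ x), le_abs_self (F.radius + 1)])
      have hK : entrySum (F.rep γ⁻¹ * (1 - x.1 * x.2)) ≤ k γ :=
        entrySum_mul_le_of_le le_rfl ((entrySum_sub_le _ _).trans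
          (add_le_add le_rfl (entrySum_mul_le_of_le h1 h2)))
      exact mul_le_mul hw (entrySum_mul_le_of_le ((entrySum_transpose _).le.trans hK) hK)
        (entrySum_nonneg _) (abs_nonneg _)
  rw [h x hx hS]
  exact (entrySum_add_le _ _).trans (add_le_add
    (entrySum_mul_le_of_le ((entrySum_transpose _).le.trans h2) h2) (hsum Φ))

/-- On a fundamental domain, unit vectors of the metric and their duals are bounded. -/
theorem exists_abs_le_of_dotProduct_metric_le_one : ∃ C : ℝ, ∀ x, IsFramePair Q x →
    pairSize x ≤ F.radius → ∀ a : Fin n → ℝ, a ⬝ᵥ F.metric x *ᵥ a ≤ 1 →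
    (∀ i, |a i| ≤ C) ∧ ∀ i, |(F.metric x *ᵥ a) i| ≤ C := by
  obtain ⟨C, hC⟩ := F.exists_entrySum_metric_le F.radius
  refine ⟨max (1 + F.radius * 1) (C * (1 + F.radius * 1)), fun x hx hS a ha => ?_⟩
  have hR : 0 ≤ F.radius := (pairSize_nonneg x).trans hS
  have hw : 1 ≤ F.weight 1 x := F.one_le_weight (by rwa [invTranslate_one])
  have hle := (F.le_dotProduct_metric hx 1 a).trans ha
  rw [dotProduct_bump, inv_one, map_one, Matrix.one_mul] at hle
  have p1 := dotProduct_self_nonneg (x.2 *ᵥ a)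
  have p2 := dotProduct_self_nonneg ((1 - x.1 * x.2) *ᵥ a)
  have h1 : (x.2 *ᵥ a) ⬝ᵥ (x.2 *ᵥ a) ≤ 1 := by nlinarith
  have h2 : ((1 - x.1 * x.2) *ᵥ a) ⬝ᵥ ((1 - x.1 * x.2) *ᵥ a) ≤ 1 := by nlinarith
  have hai : ∀ i, |a i| ≤ 1 + F.radius * 1 := fun i => by
    have e : a = (1 - x.1 * x.2) *ᵥ a + x.1 *ᵥ (x.2 *ᵥ a) := by
      rw [sub_mulVec, one_mulVec, mulVec_mulVec, sub_add_cancel]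
    have ei := congrFun e i
    rw [Pi.add_apply] at ei
    rw [ei]
    refine (abs_add_le _ _).trans (add_le_add (abs_le_one_of_dotProduct_self_le_one h2 i) ?_)
    refine (abs_mulVec_le x.1 (abs_le_one_of_dotProduct_self_le_one h1) i).trans ?_
    exact mul_le_mul_of_nonneg_right ((entrySum_fst_le x).trans hS) zero_le_one
  refine ⟨fun i => (hai i).trans (le_max_left _ _), fun i => le_max_of_le_right ?_⟩
  refine (abs_mulVec_le _ hai i).trans ?_
  exact mul_le_mul_of_nonneg_right (hC x hx hS) (by positivity)

theorem continuousOn_metric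
    {x : ℝ → Matrix (Fin n) (Fin n) ℝ × Matrix (Fin n) (Fin n) ℝ} (hx : Continuous x)
    (hQ : ∀ t, IsFramePair Q (x t)) :
    ContinuousOn (fun t => F.metric (x t)) (Set.Icc 0 1) := by
  obtain ⟨S, hS⟩ := isCompact_Icc.bddAbove_image (K := Set.Icc (0 : ℝ) 1)
    (continuous_pairSize.comp hx).continuousOn
  obtain ⟨Φ, -, h⟩ := F.exists_metric_eq S
  have hcont : Continuous fun t => (x t).2ᵀ * (x t).2 + ∑ γ ∈ Φ, F.bump γ (x t) := by
    have hw : ∀ γ, Continuous fun t => F.weight γ (x t) := fun γ => by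
      have := continuous_pairSize.comp ((continuous_invTranslate F.rep γ).comp hx)
      exact continuous_const.max (continuous_const.sub this)
    have hb : ∀ γ, Continuous fun t => F.bump γ (x t) := fun γ => by
      have := hw γ
      unfold bump
      fun_prop
    have := continuous_finsetSum Φ fun γ _ => hb γ
    fun_prop
  refine hcont.continuousOn.congr fun t ht => h _ (hQ t) (hS ⟨t, ht, rfl⟩)

end FrameAction

end FramePairs

/-! ### The leaf of frame pairs -/

section Leaf

variable {n : ℕ} {Γ : Type*} [Group Γ]

/-- `P` is an orthogonal projection and `e` a unit vector in its kernel. -/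
structure IsFlag (P : Matrix (Fin n) (Fin n) ℝ) (e : Fin n → ℝ) : Prop where
  transpose_eq : Pᵀ = P
  mul_self : P * P = P
  mulVec_eq : P *ᵥ e = 0
  dotProduct_self : e ⬝ᵥ e = 1

/-- The pair attached to a vector and a linear form. -/
def leaf (P : Matrix (Fin n) (Fin n) ℝ) (e y η : Fin n → ℝ) :
    Matrix (Fin n) (Fin n) ℝ × Matrix (Fin n) (Fin n) ℝ :=
  (vecMulVec y e + P, vecMulVec e η + P)

/-- The pairs attached to a vector and a linear form taking the value `1` on it, both in the
kernel of the projection `P`. -/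
def IsLeafPair (P : Matrix (Fin n) (Fin n) ℝ) (e : Fin n → ℝ)
    (x : Matrix (Fin n) (Fin n) ℝ × Matrix (Fin n) (Fin n) ℝ) : Prop :=
  ∃ y η, P *ᵥ y = 0 ∧ P *ᵥ η = 0 ∧ η ⬝ᵥ y = 1 ∧ x = leaf P e y η

variable {P : Matrix (Fin n) (Fin n) ℝ} {e : Fin n → ℝ}

theorem IsFlag.vecMul_eq_zero (h : IsFlag P e) {v : Fin n → ℝ} (hv : P *ᵥ v = 0) :
    v ᵥ* P = 0 := by
  rw [← h.transpose_eq, vecMul_transpose, hv]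

theorem IsFlag.leaf_fst_mul (h : IsFlag P e) (y η : Fin n → ℝ) :
    (leaf P e y η).1 * P = P := by
  simp [leaf, Matrix.add_mul, vecMulVec_mul, h.vecMul_eq_zero h.mulVec_eq, h.mul_self]

theorem IsFlag.mul_leaf_snd (h : IsFlag P e) (y η : Fin n → ℝ) :
    P * (leaf P e y η).2 = P := by
  simp [leaf, Matrix.mul_add, mul_vecMulVec, h.mulVec_eq, h.mul_self]

theorem IsLeafPair.isFramePair (h : IsFlag P e)
    {x : Matrix (Fin n) (Fin n) ℝ × Matrix (Fin n) (Fin n) ℝ} (hx : IsLeafPair P e x) :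
    IsFramePair (P + vecMulVec e e) x := by
  obtain ⟨y, η, hy, hη, hyη, rfl⟩ := hx
  constructor
  · rw [Matrix.mul_add, h.leaf_fst_mul, mul_vecMulVec]
    simp [leaf, add_mulVec, h.mulVec_eq, vecMulVec_mulVec, h.dotProduct_self, add_comm]
  · rw [Matrix.add_mul, h.mul_leaf_snd, vecMulVec_mul]
    simp [leaf, vecMul_add, h.vecMul_eq_zero h.mulVec_eq, vecMul_vecMulVec,
      h.dotProduct_self, add_comm]
  · change (vecMulVec e η + P) * (vecMulVec y e + P) = _
    rw [Matrix.mul_add, mul_vecMulVec, Matrix.add_mul, vecMulVec_mul, h.vecMul_eq_zero hη]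
    simp [add_mulVec, vecMulVec_mulVec, hy, hyη, h.mul_self, add_comm]

theorem IsLeafPair.snd_mul (h : IsFlag P e)
    {x : Matrix (Fin n) (Fin n) ℝ × Matrix (Fin n) (Fin n) ℝ} (hx : IsLeafPair P e x) :
    x.2 * P = P := by
  obtain ⟨y, η, hy, hη, hyη, rfl⟩ := hx
  simp [leaf, Matrix.add_mul, vecMulVec_mul, h.vecMul_eq_zero hη, h.mul_self]

theorem IsLeafPair.fst_mul (h : IsFlag P e)
    {x : Matrix (Fin n) (Fin n) ℝ × Matrix (Fin n) (Fin n) ℝ} (hx : IsLeafPair P e x) :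
    x.1 * P = P := by
  obtain ⟨y, η, -, -, -, rfl⟩ := hx
  exact h.leaf_fst_mul y η

theorem IsLeafPair.mul_snd (h : IsFlag P e)
    {x : Matrix (Fin n) (Fin n) ℝ × Matrix (Fin n) (Fin n) ℝ} (hx : IsLeafPair P e x) :
    P * x.2 = P := by
  obtain ⟨y, η, -, -, -, rfl⟩ := hx
  exact h.mul_leaf_snd y η

theorem continuous_leaf (P : Matrix (Fin n) (Fin n) ℝ) (e : Fin n → ℝ)
    {y η : ℝ → Fin n → ℝ} (hy : Continuous y) (hη : Continuous η) :
    Continuous fun t => leaf P e (y t) (η t) := by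
  unfold leaf
  have h1 : Continuous fun t => vecMulVec (y t) e := hy.matrix_vecMulVec continuous_const
  have h2 : Continuous fun t => vecMulVec e (η t) := continuous_const.matrix_vecMulVec hη
  fun_prop

theorem entrySum_vecMulVec_le {u v : Fin n → ℝ} {c d : ℝ} (hu : ∀ i, |u i| ≤ c)
    (hv : ∀ i, |v i| ≤ d) : entrySum (vecMulVec u v) ≤ n * (n * (c * d)) :=
  entrySum_le fun i j => by
    rw [vecMulVec_apply, abs_mul]
    exact mul_le_mul (hu i) (hv j) (abs_nonneg _) ((abs_nonneg _).trans (hu i))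

namespace FrameAction

variable (F : FrameAction Γ (P + vecMulVec e e))

theorem metric_mul_of_isLeafPair (h : IsFlag P e)
    {x : Matrix (Fin n) (Fin n) ℝ × Matrix (Fin n) (Fin n) ℝ} (hx : IsLeafPair P e x) :
    F.metric x * P = P := by
  have h2 := hx.snd_mul h
  have h2' : x.2ᵀ * P = P := by
    rw [← h.transpose_eq, ← transpose_mul, h.transpose_eq, hx.mul_snd h, h.transpose_eq]
  obtain ⟨Φ, -, hΦ⟩ := F.exists_metric_eq (pairSize x)
  have hb : ∀ γ, F.bump γ x * P = 0 := fun γ => by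
    have h0 : (1 - x.1 * x.2) * P = 0 := by
      rw [Matrix.sub_mul, Matrix.one_mul, Matrix.mul_assoc, h2, hx.fst_mul h, sub_self]
    rw [bump, Matrix.smul_mul, Matrix.mul_assoc, Matrix.mul_assoc, h0]
    simp
  rw [hΦ x (hx.isFramePair h) le_rfl, Matrix.add_mul, Matrix.mul_assoc, h2, h2',
    Finset.sum_mul]
  simp [hb]

theorem mul_metric_of_isLeafPair (h : IsFlag P e)
    {x : Matrix (Fin n) (Fin n) ℝ × Matrix (Fin n) (Fin n) ℝ} (hx : IsLeafPair P e x) :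
    P * F.metric x = P := by
  have := congrArg transpose (F.metric_mul_of_isLeafPair h hx)
  rwa [transpose_mul, F.transpose_metric (hx.isFramePair h), h.transpose_eq] at this

/-- The determinant separating two leaf pairs. -/
def sepDet (x x' : Matrix (Fin n) (Fin n) ℝ × Matrix (Fin n) (Fin n) ℝ) : ℝ :=
  (F.metric x - F.metric x' + P).det

theorem sepDet_swap (h : IsFlag P e) (hdet : (2 • P - 1).det = -1)
    {x x' : Matrix (Fin n) (Fin n) ℝ × Matrix (Fin n) (Fin n) ℝ} (hx : IsLeafPair P e x)
    (hx' : IsLeafPair P e x') : F.sepDet x' x = -F.sepDet x x' := by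
  have key : F.metric x' - F.metric x + P = (F.metric x - F.metric x' + P) * (2 • P - 1) := by
    rw [Matrix.mul_sub, Matrix.mul_one, Matrix.mul_smul, Matrix.add_mul, Matrix.sub_mul,
      F.metric_mul_of_isLeafPair h hx, F.metric_mul_of_isLeafPair h hx', h.mul_self, two_smul]
    abel
  rw [sepDet, key, det_mul, hdet, sepDet, mul_neg_one]

theorem sepDet_path_mul_pos (h : IsFlag P e)
    {x x' : ℝ → Matrix (Fin n) (Fin n) ℝ × Matrix (Fin n) (Fin n) ℝ}
    (hx : Continuous x) (hx' : Continuous x')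
    (hl : ∀ t, IsLeafPair P e (x t)) (hl' : ∀ t, IsLeafPair P e (x' t))
    (h0 : ∀ t ∈ Set.Icc (0 : ℝ) 1, F.sepDet (x t) (x' t) ≠ 0) :
    0 < F.sepDet (x 0) (x' 0) * F.sepDet (x 1) (x' 1) := by
  refine mul_pos_of_continuousOn_Icc (f := fun t => F.sepDet (x t) (x' t)) ?_ h0
  have c1 := F.continuousOn_metric hx fun t => (hl t).isFramePair h
  have c2 := F.continuousOn_metric hx' fun t => (hl' t).isFramePair h
  have : ContinuousOn (fun t => F.metric (x t) - F.metric (x' t) + P) (Set.Icc 0 1) :=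
    (c1.sub c2).add continuousOn_const
  exact (Continuous.matrix_det continuous_id).comp_continuousOn this

theorem isLeafPair_leaf_metric (h : IsFlag P e)
    {x : Matrix (Fin n) (Fin n) ℝ × Matrix (Fin n) (Fin n) ℝ} (hx : IsLeafPair P e x)
    {a : Fin n → ℝ} (ha : P *ᵥ a = 0) (ha1 : a ⬝ᵥ F.metric x *ᵥ a = 1) :
    IsLeafPair P e (leaf P e a (F.metric x *ᵥ a)) :=
  ⟨a, _, ha, by rw [mulVec_mulVec, F.mul_metric_of_isLeafPair h hx, ha],
    by rw [dotProduct_comm, ha1], rfl⟩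

/-- The leaf pairs formed by a unit vector and its dual with respect to the metric of a pair
stay at bounded distance from that pair. -/
theorem exists_leaf_metric_bound (h : IsFlag P e) : ∃ S : ℝ, ∀ γ x, IsLeafPair P e x →
    pairSize (invTranslate F.rep γ x) ≤ F.radius → ∀ a : Fin n → ℝ,
    a ⬝ᵥ F.metric x *ᵥ a = 1 →
    pairSize (invTranslate F.rep γ (leaf P e a (F.metric x *ᵥ a))) ≤ S := by
  obtain ⟨C, hC⟩ := F.exists_abs_le_of_dotProduct_metric_le_one
  refine ⟨(n * (n * (C * 1)) + F.radius * entrySum P) +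
    (n * (n * (1 * C)) + entrySum P * F.radius), fun γ x hx hS a ha => ?_⟩
  have hframe := hx.isFramePair h
  have hme : F.metric (invTranslate F.rep γ x) *ᵥ (F.rep γ⁻¹ *ᵥ a) =
      (F.rep γ)ᵀ *ᵥ (F.metric x *ᵥ a) := by
    rw [F.metric_invTranslate hframe, mulVec_mulVec, Matrix.mul_assoc, rep_mul_inv,
      Matrix.mul_one, mulVec_mulVec]
  have hone : (F.rep γ⁻¹ *ᵥ a) ⬝ᵥ F.metric (invTranslate F.rep γ x) *ᵥ (F.rep γ⁻¹ *ᵥ a) = 1 := by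
    rw [hme, dotProduct_mulVec, vecMul_transpose, mulVec_mulVec, rep_mul_inv, one_mulVec, ha]
  obtain ⟨b1, b2⟩ := hC _ (hframe.invTranslate F.rep γ) hS _ hone.le
  rw [hme] at b2
  have he : ∀ i, |e i| ≤ 1 := abs_le_one_of_dotProduct_self_le_one h.dotProduct_self.le
  have e1 : F.rep γ⁻¹ * (vecMulVec a e + P) =
      vecMulVec (F.rep γ⁻¹ *ᵥ a) e + (invTranslate F.rep γ x).1 * P := by
    rw [Matrix.mul_add, mul_vecMulVec, invTranslate, Matrix.mul_assoc, hx.fst_mul h]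
  have e2 : (vecMulVec e (F.metric x *ᵥ a) + P) * F.rep γ =
      vecMulVec e ((F.rep γ)ᵀ *ᵥ (F.metric x *ᵥ a)) + P * (invTranslate F.rep γ x).2 := by
    rw [Matrix.add_mul, vecMulVec_mul, invTranslate, ← Matrix.mul_assoc, hx.mul_snd h,
      mulVec_transpose]
  refine add_le_add ?_ ?_
  · change entrySum (F.rep γ⁻¹ * (vecMulVec a e + P)) ≤ _
    rw [e1]
    exact (entrySum_add_le _ _).trans (add_le_add (entrySum_vecMulVec_le b1 he)
      (entrySum_mul_le_of_le ((entrySum_fst_le _).trans hS) le_rfl))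
  · change entrySum ((vecMulVec e (F.metric x *ᵥ a) + P) * F.rep γ) ≤ _
    rw [e2]
    exact (entrySum_add_le _ _).trans (add_le_add (entrySum_vecMulVec_le he b2)
      (entrySum_mul_le_of_le le_rfl ((entrySum_snd_le _).trans hS)))

theorem exists_mulVec_eq_of_sepDet_eq_zero (h : IsFlag P e)
    {x x' : Matrix (Fin n) (Fin n) ℝ × Matrix (Fin n) (Fin n) ℝ} (hx : IsLeafPair P e x)
    (hx' : IsLeafPair P e x') (h0 : F.sepDet x x' = 0) :
    ∃ a : Fin n → ℝ, P *ᵥ a = 0 ∧ F.metric x *ᵥ a = F.metric x' *ᵥ a ∧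
      a ⬝ᵥ F.metric x *ᵥ a = 1 := by
  obtain ⟨v, hv0, hv⟩ := exists_mulVec_eq_zero_iff.mpr h0
  have hPv : P *ᵥ v = 0 := by
    have := congrArg (P *ᵥ ·) hv
    simpa [mulVec_mulVec, Matrix.mul_add, Matrix.mul_sub, F.mul_metric_of_isLeafPair h hx,
      F.mul_metric_of_isLeafPair h hx', h.mul_self] using this
  have hM : F.metric x *ᵥ v = F.metric x' *ᵥ v := by
    rw [add_mulVec, hPv, add_zero, sub_mulVec] at hv
    exact sub_eq_zero.mp hv
  have hpos := F.dotProduct_metric_pos (hx.isFramePair h) hv0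
  set c := v ⬝ᵥ F.metric x *ᵥ v with hc
  refine ⟨(√c)⁻¹ • v, by rw [mulVec_smul, hPv, smul_zero], by simp only [mulVec_smul, hM], ?_⟩
  rw [mulVec_smul, smul_dotProduct, dotProduct_smul, ← hc, smul_eq_mul, smul_eq_mul,
    ← mul_assoc, ← mul_inv, Real.mul_self_sqrt hpos.le, inv_mul_cancel₀ hpos.ne']

/-- Leaf pairs at which the separating determinant vanishes are at bounded distance. -/
theorem exists_bound_of_sepDet_eq_zero (h : IsFlag P e) : ∃ C : ℝ, 0 ≤ C ∧ ∀ γ x x',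
    IsLeafPair P e x → IsLeafPair P e x' → pairSize (invTranslate F.rep γ x) ≤ F.radius →
    F.sepDet x x' = 0 → pairSize (invTranslate F.rep γ x') ≤ C := by
  obtain ⟨S, hS⟩ := F.exists_leaf_metric_bound h
  obtain ⟨C, hC⟩ := F.exists_transfer_bound (max S F.radius)
  refine ⟨max C 0, le_max_right _ _, fun γ x x' hx hx' hr h0 => le_max_of_le_left ?_⟩
  obtain ⟨a, ha, hM, ha1⟩ := F.exists_mulVec_eq_of_sepDet_eq_zero h hx hx' h0
  obtain ⟨γ', hγ'⟩ := F.cover x' (hx'.isFramePair h)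
  have h1 := hS γ x hx hr a ha1
  have h2 := hS γ' x' hx' hγ' a (by rw [← hM, ha1])
  rw [← hM] at h2
  exact hC γ γ' _ x' ((F.isLeafPair_leaf_metric h hx ha ha1).isFramePair h)
    (h1.trans (le_max_left _ _)) (h2.trans (le_max_left _ _)) (hγ'.trans (le_max_right _ _))

theorem sepDet_mul_pos_of_far (h : IsFlag P e)
    (hD : ∀ y z : Fin n → ℝ, ∃ ζ, P *ᵥ ζ = 0 ∧ ζ ≠ 0 ∧ ζ ⬝ᵥ y = 0 ∧ ζ ⬝ᵥ z = 0)
    {C : ℝ} (hC : ∀ γ x x',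
      IsLeafPair P e x → IsLeafPair P e x' → pairSize (invTranslate F.rep γ x) ≤ F.radius →
      F.sepDet x x' = 0 → pairSize (invTranslate F.rep γ x') ≤ C)
    {γ : Γ} {x x' x'' : Matrix (Fin n) (Fin n) ℝ × Matrix (Fin n) (Fin n) ℝ}
    (hx : IsLeafPair P e x) (hx' : IsLeafPair P e x') (hx'' : IsLeafPair P e x'')
    (hr : pairSize (invTranslate F.rep γ x) ≤ F.radius)
    (hr' : 2 * C < pairSize (invTranslate F.rep γ x'))
    (hr'' : 2 * C < pairSize (invTranslate F.rep γ x'')) :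
    0 < F.sepDet x x' * F.sepDet x x'' := by
  obtain ⟨y', η', hy', hη', h1', rfl⟩ := hx'
  obtain ⟨y'', η'', hy'', hη'', h1'', rfl⟩ := hx''
  have he : e ≠ 0 := fun h0 => by simpa [h0] using h.dotProduct_self
  let D : Submodule ℝ (Fin n → ℝ) := LinearMap.ker P.mulVecLin
  have hmem : ∀ v, v ∈ D ↔ P *ᵥ v = 0 := fun v => Iff.rfl
  have hfar : ∀ y η, P *ᵥ y = 0 → P *ᵥ η = 0 → η ⬝ᵥ y = 1 →
      (C < entrySum (F.rep γ⁻¹ * (vecMulVec y e + P)) ∨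
        C < entrySum ((vecMulVec e η + P) * F.rep γ)) → F.sepDet x (leaf P e y η) ≠ 0 := by
    intro y η hy hη hyη hlt h0
    have hle := hC γ x _ hx ⟨y, η, hy, hη, hyη, rfl⟩ hr h0
    have l1 := entrySum_fst_le (invTranslate F.rep γ (leaf P e y η))
    have l2 := entrySum_snd_le (invTranslate F.rep γ (leaf P e y η))
    rcases hlt with hlt | hlt
    · exact absurd (hlt.trans_le (l1.trans hle)) (lt_irrefl _)
    · exact absurd (hlt.trans_le (l2.trans hle)) (lt_irrefl _)
  have hor : ∀ y η, 2 * C < pairSize (invTranslate F.rep γ (leaf P e y η)) →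
      (C < entrySum (F.rep γ⁻¹ * (vecMulVec y e + P)) ∨
        C < entrySum ((vecMulVec e η + P) * F.rep γ)) := by
    intro y η hlt
    by_contra! hle
    have : pairSize (invTranslate F.rep γ (leaf P e y η)) ≤ C + C := add_le_add hle.1 hle.2
    linarith
  have hline : ∀ u v : Fin n → ℝ, Continuous fun t : ℝ => u + t • (v - u) := fun u v => by
    fun_prop
  have hmemline : ∀ {u v : Fin n → ℝ}, P *ᵥ u = 0 → P *ᵥ v = 0 → ∀ t : ℝ,
      P *ᵥ (u + t • (v - u)) = 0 := fun hu hv t => by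
    rw [mulVec_add, mulVec_smul, mulVec_sub, hu, hv]; simp
  refine mul_pos_of_sign_const D (fun y z => ?_)
    (fun y => C < entrySum (F.rep γ⁻¹ * (vecMulVec y e + P)))
    (fun η => C < entrySum ((vecMulVec e η + P) * F.rep γ)) ?_ ?_
    (fun y η => F.sepDet x (leaf P e y η)) ?_ ?_ hy' hη' hy'' hη'' h1' h1''
    (hor _ _ hr') (hor _ _ hr'')
  · obtain ⟨ζ, hζ, hζ'⟩ := hD y z
    exact ⟨ζ, hζ, hζ'⟩
  · intro y ζ hζ
    have hB : F.rep γ⁻¹ * vecMulVec ζ e ≠ 0 := fun h0 => by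
      have := congrArg (F.rep γ * ·) h0
      simp only [← Matrix.mul_assoc, rep_mul_inv, Matrix.one_mul, Matrix.mul_zero] at this
      exact (vecMulVec_ne_zero hζ he) this
    obtain ⟨t, ht, hlt⟩ := exists_lt_entrySum_add_smul
      (F.rep γ⁻¹ * (vecMulVec y e + P)) hB C
    refine ⟨t, ht, ?_⟩
    convert hlt using 2
    rw [add_vecMulVec, smul_vecMulVec]
    simp only [Matrix.mul_add, Matrix.mul_smul]
    abel
  · intro η ζ hζ
    have hB : vecMulVec e ζ * F.rep γ ≠ 0 := fun h0 => by
      have := congrArg (· * F.rep γ⁻¹) h0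
      simp only [Matrix.mul_assoc, rep_mul_inv, Matrix.mul_one, Matrix.zero_mul] at this
      exact (vecMulVec_ne_zero he hζ) this
    obtain ⟨t, ht, hlt⟩ := exists_lt_entrySum_add_smul
      ((vecMulVec e η + P) * F.rep γ) hB C
    refine ⟨t, ht, ?_⟩
    convert hlt using 2
    rw [vecMulVec_add, vecMulVec_smul]
    simp only [Matrix.add_mul, Matrix.smul_mul]
    abel
  · intro y hy η hη θ hθ hyη hyθ hlt
    have hdot : ∀ t : ℝ, (η + t • (θ - η)) ⬝ᵥ y = 1 := fun t => by
      rw [add_dotProduct, smul_dotProduct, sub_dotProduct, hyη, hyθ]; simp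
    have := F.sepDet_path_mul_pos h (x := fun _ => x)
      (x' := fun t => leaf P e y (η + t • (θ - η))) continuous_const
      (continuous_leaf P e continuous_const (hline η θ)) (fun _ => hx)
      (fun t => ⟨y, _, hy, hmemline hη hθ t, hdot t, rfl⟩)
      (fun t _ => hfar _ _ hy (hmemline hη hθ t) (hdot t) (Or.inl hlt))
    simpa using this
  · intro η hη y hy z hz hyη hzη hlt
    have hdot : ∀ t : ℝ, η ⬝ᵥ (y + t • (z - y)) = 1 := fun t => by
      rw [dotProduct_add, dotProduct_smul, dotProduct_sub, hyη, hzη]; simp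
    have := F.sepDet_path_mul_pos h (x := fun _ => x)
      (x' := fun t => leaf P e (y + t • (z - y)) η) continuous_const
      (continuous_leaf P e (hline y z) continuous_const) (fun _ => hx)
      (fun t => ⟨_, η, hmemline hy hz t, hη, hdot t, rfl⟩)
      (fun t _ => hfar _ _ (hmemline hy hz t) hη (hdot t) (Or.inr hlt))
    simpa using this

/-- There is no proper cocompact action on frame pairs when the reflection `2 • P - 1` reverses
the orientation and any two vectors have a common nonzero orthogonal vector in the kernel
of `P`. -/
theorem false_of_det_eq_neg_one (F : FrameAction Γ (P + vecMulVec e e)) (h : IsFlag P e)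
    (hdet : (2 • P - 1).det = -1)
    (hD : ∀ y z : Fin n → ℝ, ∃ ζ, P *ᵥ ζ = 0 ∧ ζ ≠ 0 ∧ ζ ⬝ᵥ y = 0 ∧ ζ ⬝ᵥ z = 0) : False := by
  obtain ⟨C, hC0, hC⟩ := F.exists_bound_of_sepDet_eq_zero h
  obtain ⟨u, hu, hu0, hue, -⟩ := hD e e
  have he : e ≠ 0 := fun h0 => by simpa [h0] using h.dotProduct_self
  let pt : ℝ → Matrix (Fin n) (Fin n) ℝ × Matrix (Fin n) (Fin n) ℝ :=
    fun t => leaf P e (e + t • u) e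
  have hpt : ∀ t, IsLeafPair P e (pt t) := fun t => by
    refine ⟨_, e, ?_, h.mulVec_eq, ?_, rfl⟩
    · rw [mulVec_add, mulVec_smul, h.mulVec_eq, hu]; simp
    · rw [dotProduct_add, dotProduct_smul, dotProduct_comm e u, hue, h.dotProduct_self]; simp
  have hcont : Continuous pt := continuous_leaf P e (by fun_prop) continuous_const
  have hlarge : ∀ S, ∃ t, S < pairSize (pt t) := fun S => by
    obtain ⟨t, -, ht⟩ := exists_lt_entrySum_add_smul (vecMulVec e e + P)
      (vecMulVec_ne_zero hu0 he) S
    refine ⟨t, (ht.trans_le (le_of_eq ?_)).trans_le (entrySum_fst_le _)⟩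
    simp only [pt, leaf, add_vecMulVec, smul_vecMulVec]
    congr 1
    abel
  have hesc : ∀ S, ∃ S', ∀ γ p x, IsLeafPair P e p → pairSize p ≤ S → S' < pairSize x →
      pairSize (invTranslate F.rep γ p) ≤ S → S < pairSize (invTranslate F.rep γ x) := by
    intro S
    obtain ⟨S', hS'⟩ := F.exists_transfer_bound S
    refine ⟨S', fun γ p x hp hpS hx hγp => lt_of_not_ge fun hγx => hx.not_ge ?_⟩
    simpa [invTranslate_one] using hS' 1 γ p x (hp.isFramePair h)
      (by rwa [invTranslate_one]) hγp hγx
  obtain ⟨γa, hγa⟩ := F.cover (pt 0) ((hpt 0).isFramePair h)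
  obtain ⟨S₁, hS₁⟩ := hesc (max (max F.radius (2 * C)) (pairSize (pt 0)))
  obtain ⟨T, hT⟩ := hlarge S₁
  obtain ⟨γb, hγb⟩ := F.cover (pt T) ((hpt T).isFramePair h)
  let seg : ℝ → Matrix (Fin n) (Fin n) ℝ × Matrix (Fin n) (Fin n) ℝ := fun s => pt (s * T)
  have hseg : Continuous seg := hcont.comp (by fun_prop)
  obtain ⟨S₂, hS₂⟩ := isCompact_Icc.bddAbove_image (K := Set.Icc (0 : ℝ) 1)
    (continuous_pairSize.comp hseg).continuousOn
  have hS₂' : ∀ s ∈ Set.Icc (0 : ℝ) 1, pairSize (seg s) ≤ S₂ := fun s hs => hS₂ ⟨s, hs, rfl⟩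
  obtain ⟨S₃, hS₃⟩ := hesc (max (max F.radius (2 * C)) S₂)
  obtain ⟨T', hT'⟩ := hlarge S₃
  have far : ∀ s ∈ Set.Icc (0 : ℝ) 1, ∀ γ,
      pairSize (invTranslate F.rep γ (seg s)) ≤ F.radius →
      2 * C < pairSize (invTranslate F.rep γ (pt T')) := fun s hs γ hγ =>
    lt_of_le_of_lt ((le_max_right _ _).trans (le_max_left _ _))
      (hS₃ γ (seg s) (pt T') (hpt _) ((hS₂' s hs).trans (le_max_right _ _)) hT'
        (hγ.trans ((le_max_left _ _).trans (le_max_left _ _))))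
  have hseg0 : seg 0 = pt 0 := by simp [seg]
  have hseg1 : seg 1 = pt T := by simp [seg]
  have hab : 2 * C < pairSize (invTranslate F.rep γa (pt T)) :=
    lt_of_le_of_lt ((le_max_right _ _).trans (le_max_left _ _))
      (hS₁ γa (pt 0) (pt T) (hpt 0) (le_max_right _ _) hT
        (hγa.trans ((le_max_left _ _).trans (le_max_left _ _))))
  have hba : 2 * C < pairSize (invTranslate F.rep γb (pt 0)) := by
    by_contra! hle
    have := hS₁ γb (pt 0) (pt T) (hpt 0) (le_max_right _ _) hT
      (hle.trans ((le_max_right _ _).trans (le_max_left _ _)))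
    exact absurd (this.trans_le (hγb.trans ((le_max_left _ _).trans (le_max_left _ _))))
      (lt_irrefl _)
  have p1 : 0 < F.sepDet (pt 0) (pt T) * F.sepDet (pt 0) (pt T') :=
    F.sepDet_mul_pos_of_far h hD hC (hpt _) (hpt _) (hpt _) hγa hab
      (far 0 (by simp) γa (by rwa [hseg0]))
  have p2 : 0 < F.sepDet (pt T) (pt T') * F.sepDet (pt T) (pt 0) :=
    F.sepDet_mul_pos_of_far h hD hC (hpt _) (hpt _) (hpt _) hγb
      (far 1 (by simp) γb (by rwa [hseg1])) hba
  have p3 : 0 < F.sepDet (pt 0) (pt T') * F.sepDet (pt T) (pt T') := by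
    rw [← hseg0, ← hseg1]
    refine F.sepDet_path_mul_pos h (x' := fun _ => pt T') hseg continuous_const
      (fun _ => hpt _) (fun _ => hpt _) fun s hs h0 => ?_
    obtain ⟨γ, hγ⟩ := F.cover (seg s) ((hpt _).isFramePair h)
    have := far s hs γ hγ
    have := hC γ _ _ (hpt _) (hpt _) hγ h0
    linarith
  have p4 := mul_pos_trans p1 (mul_pos_trans p3 p2)
  rw [F.sepDet_swap h hdet (hpt 0) (hpt T)] at p4
  nlinarith [mul_self_nonneg (F.sepDet (pt 0) (pt T))]

end FrameAction

end Leaf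

/-! ### Frame pairs of the standard coordinate projections -/

section StandardFlag

theorem diagonal_dvec_mul_self (k n : ℕ) :
    diagonal (dvec k n) * diagonal (dvec k n) = diagonal (dvec k n) := by
  rw [diagonal_mul_diagonal]
  congr 1
  ext i
  simp [dvec]

theorem isFlag_diagonal_dvec {m n : ℕ} (hmn : m < n) :
    IsFlag (diagonal (dvec (m + 1) n)) (Pi.single ⟨m, hmn⟩ 1) where
  transpose_eq := diagonal_transpose _
  mul_self := diagonal_dvec_mul_self _ _
  mulVec_eq := by
    ext i
    rw [mulVec_diagonal]
    by_cases hi : i = ⟨m, hmn⟩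
    · simp [hi, dvec]
    · simp [hi]
  dotProduct_self := by simp

theorem diagonal_dvec_add_vecMulVec {m n : ℕ} (hmn : m < n) :
    diagonal (dvec (m + 1) n) +
      vecMulVec (Pi.single ⟨m, hmn⟩ 1) (Pi.single ⟨m, hmn⟩ 1) = diagonal (dvec m n) := by
  ext i j
  rw [Matrix.add_apply, vecMulVec_apply, diagonal_apply, diagonal_apply]
  by_cases hij : i = j
  · subst hij
    by_cases hi : i = ⟨m, hmn⟩
    · simp [hi, dvec]
    · have hne : (i : ℕ) ≠ m := fun h => hi (Fin.ext h)
      have : (m + 1 ≤ (i : ℕ)) ↔ (m ≤ (i : ℕ)) := by omega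
      simp [hi, dvec, this]
  · by_cases hi : i = ⟨m, hmn⟩
    · have hj : j ≠ ⟨m, hmn⟩ := fun h => hij (hi.trans h.symm)
      simp [hij, hj]
    · simp [hij, hi]

theorem det_two_smul_diagonal_dvec_sub_one {m n : ℕ} (hmn : m < n) (hm : Even m) :
    (2 • diagonal (dvec (m + 1) n) - 1 : Matrix (Fin n) (Fin n) ℝ).det = -1 := by
  have e : (2 • diagonal (dvec (m + 1) n) - 1 : Matrix (Fin n) (Fin n) ℝ) =
      diagonal fun i : Fin n => if m + 1 ≤ (i : ℕ) then 1 else -1 := by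
    rw [← diagonal_one, ← diagonal_smul, diagonal_sub]
    congr 1
    ext i
    by_cases hi : m + 1 ≤ (i : ℕ)
    · simp [dvec, hi]; norm_num
    · simp [dvec, hi]
  obtain ⟨k, rfl⟩ := Nat.exists_eq_add_of_lt hmn
  rw [e, det_diagonal,
    Fin.prod_univ_eq_prod_range (fun i => if m + 1 ≤ i then (1 : ℝ) else -1) (m + k + 1),
    show m + k + 1 = (m + 1) + k by ring, Finset.prod_range_add]
  have h1 : ∏ i ∈ Finset.range (m + 1), (if m + 1 ≤ i then (1 : ℝ) else -1) = -1 := by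
    rw [Finset.prod_congr rfl fun i hi =>
      if_neg (not_le.mpr (Finset.mem_range.mp hi)), Finset.prod_const, Finset.card_range]
    exact hm.add_one.neg_one_pow
  rw [h1]
  simp

theorem exists_mem_ker_diagonal_dvec {m n : ℕ} (hm : 1 < m) (hmn : m < n) (y z : Fin n → ℝ) :
    ∃ ζ, diagonal (dvec (m + 1) n) *ᵥ ζ = 0 ∧ ζ ≠ 0 ∧ ζ ⬝ᵥ y = 0 ∧ ζ ⬝ᵥ z = 0 := by
  let i₀ : Fin n := ⟨0, by omega⟩
  let i₁ : Fin n := ⟨1, by omega⟩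
  let i₂ : Fin n := ⟨m, hmn⟩
  obtain ⟨c, hc0, hc⟩ := exists_mulVec_eq_zero_iff.mpr
    (show det !![y i₀, y i₁, y i₂; z i₀, z i₁, z i₂; 0, 0, 0] = 0 by simp [det_fin_three])
  have hy := congrFun hc 0
  have hz := congrFun hc 1
  simp only [mulVec, dotProduct, Fin.sum_univ_three, of_apply, cons_val, Pi.zero_apply]
    at hy hz
  have h01 : i₀ ≠ i₁ := by simp [i₀, i₁]
  have h02 : i₀ ≠ i₂ := by simp [i₀, i₂]; omega
  have h12 : i₁ ≠ i₂ := by simp [i₁, i₂]; omega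
  refine ⟨Pi.single i₀ (c 0) + Pi.single i₁ (c 1) + Pi.single i₂ (c 2), ?_, fun h0 => hc0 ?_,
    ?_, ?_⟩
  · have hs : ∀ i : Fin n, (i : ℕ) ≤ m → ∀ t : ℝ,
        diagonal (dvec (m + 1) n) *ᵥ Pi.single i t = 0 := by
      intro i hi t
      ext j
      rw [mulVec_diagonal]
      by_cases hj : j = i
      · subst hj
        simp [dvec, hi]
      · simp [hj]
    rw [mulVec_add, mulVec_add, hs i₀ (by simp [i₀]), hs i₁ (by simp [i₁]; omega),
      hs i₂ (by simp [i₂])]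
    simp
  · ext k
    fin_cases k
    · simpa [h01, h02] using congrFun h0 i₀
    · simpa [h01.symm, h12] using congrFun h0 i₁
    · simpa [h02.symm, h12.symm] using congrFun h0 i₂
  · simp only [add_dotProduct, single_dotProduct]
    linarith
  · simp only [add_dotProduct, single_dotProduct]
    linarith

theorem IsFramePair.finrank_ker {m n : ℕ} (hmn : m ≤ n)
    {x : Matrix (Fin n) (Fin n) ℝ × Matrix (Fin n) (Fin n) ℝ}
    (hx : IsFramePair (diagonal (dvec m n)) x) :
    Module.finrank ℝ (LinearMap.ker (toLpLin 2 2 x.2)) = m := by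
  have hrank : x.2.rank = (diagonal (dvec m n)).rank := by
    apply le_antisymm
    · calc x.2.rank = (diagonal (dvec m n) * x.2).rank := by rw [hx.mul_snd]
        _ ≤ _ := rank_mul_le_left _ _
    · rw [← hx.snd_mul_fst]
      exact rank_mul_le_left _ _
  have hcard : (diagonal (dvec m n)).rank = n - m := by
    rw [rank_diagonal]
    have : ∀ i : Fin n, dvec m n i ≠ 0 ↔ ¬ (i : ℕ) < m := fun i => by simp [dvec]
    simp only [this]
    rw [Fintype.card_subtype_compl, Fintype.card_fin]
    congr 1
    rw [Fintype.card_subtype]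
    simpa [hmn] using Fin.card_filter_val_lt (n := n) (m := m)
  have h := LinearMap.finrank_range_add_finrank_ker (toLpLin 2 2 x.2)
  rw [toLpLin_eq_toLin, ← rank_eq_finrank_range_toLin, hrank, hcard,
    finrank_euclideanSpace_fin, ← toLpLin_eq_toLin] at h
  omega

/-- An orthonormal basis of the kernel of the second component of a frame pair, as a matrix. -/
theorem IsFramePair.exists_orthonormal_complement {m n : ℕ} (hmn : m ≤ n)
    {x : Matrix (Fin n) (Fin n) ℝ × Matrix (Fin n) (Fin n) ℝ}
    (hx : IsFramePair (diagonal (dvec m n)) x) :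
    ∃ W : Matrix (Fin n) (Fin n) ℝ, Wᵀ * W = 1 - diagonal (dvec m n) ∧ x.2 * W = 0 ∧
      W * diagonal (dvec m n) = 0 := by
  let b := (stdOrthonormalBasis ℝ (LinearMap.ker (toLpLin 2 2 x.2))).reindex
    (finCongr (hx.finrank_ker hmn))
  let W : Matrix (Fin n) (Fin n) ℝ := of fun i j =>
    if h : (j : ℕ) < m then (b ⟨j, h⟩ : EuclideanSpace ℝ (Fin n)) i else 0
  refine ⟨W, ?_, ?_, ?_⟩
  · ext i j
    rw [Matrix.mul_apply, Matrix.sub_apply, one_apply, diagonal_apply]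
    by_cases hi : (i : ℕ) < m
    · by_cases hj : (j : ℕ) < m
      · have h := b.inner_eq_ite ⟨i, hi⟩ ⟨j, hj⟩
        rw [Submodule.coe_inner, PiLp.inner_apply] at h
        have e : ∑ k, Wᵀ i k * W k j = if (⟨i, hi⟩ : Fin m) = ⟨j, hj⟩ then 1 else 0 := by
          rw [← h]
          refine Finset.sum_congr rfl fun k _ => ?_
          simp [W, hi, hj, mul_comm]
        rw [e]
        by_cases hij : i = j
        · subst hij
          simp [dvec, not_le.mpr hi]
        · have : (i : ℕ) ≠ j := fun h => hij (Fin.ext h)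
          simp [hij, this]
      · have hij : i ≠ j := fun h => hj (h ▸ hi)
        simp [W, hj, hij]
    · by_cases hij : i = j
      · subst hij
        simp [W, hi, dvec, not_lt.mp hi]
      · simp [W, hi, hij]
  · ext i j
    rw [Matrix.mul_apply]
    by_cases hj : (j : ℕ) < m
    · have h : toLpLin 2 2 x.2 (b ⟨j, hj⟩ : EuclideanSpace ℝ (Fin n)) = 0 := (b ⟨j, hj⟩).2
      have hi := congrArg (fun v : EuclideanSpace ℝ (Fin n) => v i) h
      rw [toLpLin_apply] at hi
      refine Eq.trans (Finset.sum_congr rfl fun k _ => ?_) hi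
      simp [W, hj]
    · simp [W, hj]
  · ext i j
    rw [mul_diagonal]
    by_cases hj : (j : ℕ) < m
    · simp [dvec, hj]
    · simp [W, hj]

/-- Frame pairs of bounded size come from matrices of determinant one of bounded size. -/
theorem exists_det_eq_one_of_isFramePair {m n : ℕ} (hm : 0 < m) (hmn : m ≤ n) (S : ℝ) :
    ∃ C : ℝ, ∀ x, IsFramePair (diagonal (dvec m n)) x → pairSize x ≤ S →
      ∃ g : Matrix (Fin n) (Fin n) ℝ, g.det = 1 ∧ g * diagonal (dvec m n) = x.1 ∧
        x.2 * g = diagonal (dvec m n) ∧ entrySum g ≤ C := by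
  set Q := diagonal (dvec m n) with hQ
  let w : ℝ := n * (n * 1)
  let l : ℝ := w * (entrySum (1 : Matrix (Fin n) (Fin n) ℝ) + S * S) + S
  let d : ℝ := (n.factorial : ℝ) * l ^ n
  refine ⟨(w + S) * (n * (n * (1 + d))), fun x hx hS => ?_⟩
  obtain ⟨W, hW, hBW, hWQ⟩ := hx.exists_orthonormal_complement hmn
  have hA := (entrySum_fst_le x).trans hS
  have hB := (entrySum_snd_le x).trans hS
  have hWe : entrySum W ≤ w := by
    refine entrySum_le fun i j => ?_
    refine FrameAction.abs_le_one_of_dotProduct_self_le_one (v := fun i => W i j) ?_ i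
    have h := congrFun (congrFun hW j) j
    have : (fun i => W i j) ⬝ᵥ (fun i => W i j) = (1 - Q) j j := h
    rw [this, Matrix.sub_apply, one_apply_eq, hQ, diagonal_apply_eq, dvec]
    split_ifs <;> norm_num
  set G := W + x.1 with hG
  set L := Wᵀ * (1 - x.1 * x.2) + x.2 with hL
  have hBG : x.2 * G = Q := by rw [hG, Matrix.mul_add, hBW, zero_add, hx.snd_mul_fst]
  have hGQ : G * Q = x.1 := by rw [hG, Matrix.add_mul, hWQ, zero_add, hx.fst_mul]
  have hLG : L * G = 1 := by
    rw [hL, Matrix.add_mul, Matrix.mul_assoc, Matrix.sub_mul, Matrix.one_mul,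
      Matrix.mul_assoc x.1, hBG, hx.fst_mul, hG, add_sub_cancel_right, hW, sub_add_cancel]
  have hdet : L.det * G.det = 1 := by rw [← det_mul, hLG, det_one]
  have hLe : entrySum L ≤ l :=
    (entrySum_add_le _ _).trans (add_le_add (entrySum_mul_le_of_le
      ((entrySum_transpose _).le.trans hWe) ((entrySum_sub_le _ _).trans
        (add_le_add le_rfl (entrySum_mul_le_of_le hA hB)))) hB)
  have hLd : |L.det| ≤ d := by
    have := det_le (A := L) (abv := AbsoluteValue.abs) (x := l)
      fun i j => (abs_apply_le_entrySum L i j).trans hLe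
    simpa [d, nsmul_eq_mul] using this
  let i₀ : Fin n := ⟨0, by omega⟩
  let v : Fin n → ℝ := Function.update 1 i₀ L.det
  have hvQ : diagonal v * Q = Q := by
    rw [hQ, diagonal_mul_diagonal]
    congr 1
    ext i
    by_cases hi : i = i₀
    · subst hi
      simp [dvec, i₀, hm.ne']
    · simp [v, hi]
  have hQv : Q * diagonal v = Q := by
    rw [hQ, diagonal_mul_diagonal] at hvQ ⊢
    simpa only [mul_comm] using hvQ
  refine ⟨G * diagonal v, ?_, ?_, ?_, ?_⟩
  · rw [det_mul, det_diagonal, Finset.prod_update_of_mem (Finset.mem_univ _)]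
    simpa [mul_comm] using hdet
  · rw [Matrix.mul_assoc, hvQ, hGQ]
  · rw [← Matrix.mul_assoc, hBG, hQv]
  · refine entrySum_mul_le_of_le ((entrySum_add_le _ _).trans (add_le_add hWe hA))
      (entrySum_le fun i j => ?_)
    have hd : 0 ≤ d := (abs_nonneg _).trans hLd
    rw [diagonal_apply]
    split_ifs
    · by_cases hi : i = i₀
      · subst hi
        simp only [v, Function.update_self]
        linarith
      · simp [v, hi, hd]
    · simp only [abs_zero]
      linarith

end StandardFlag

/-! ### The homogeneous space as a space of frame pairs -/

section HomogeneousSpace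

variable {m n : ℕ}

theorem SLR.mul_inv_val (g : ↥(SLR n)) : g.val.val * (g⁻¹).val.val = 1 :=
  Units.mul_inv g.val

theorem SLR.inv_mul_val (g : ↥(SLR n)) : (g⁻¹).val.val * g.val.val = 1 :=
  Units.inv_mul g.val

theorem mem_SLRsub_iff (g : ↥(SLR n)) :
    g ∈ SLRsub m n ↔ g.val.val * diagonal (dvec m n) = diagonal (dvec m n) ∧
      diagonal (dvec m n) * g.val.val = diagonal (dvec m n) :=
  blockCond_iff m n g.val.val

theorem cosetPair_wellDefined (g h : ↥(SLR n)) :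
    g⁻¹ * h ∈ SLRsub m n ↔
      (g.val.val * diagonal (dvec m n), diagonal (dvec m n) * (g⁻¹).val.val) =
        (h.val.val * diagonal (dvec m n), diagonal (dvec m n) * (h⁻¹).val.val) := by
  have e : (g⁻¹ * h).val.val = (g⁻¹).val.val * h.val.val := rfl
  rw [mem_SLRsub_iff, e, Prod.mk.injEq]
  refine and_congr ⟨fun h1 => ?_, fun h1 => ?_⟩ ⟨fun h2 => ?_, fun h2 => ?_⟩
  · nth_rewrite 1 [← h1]
    rw [Matrix.mul_assoc, ← Matrix.mul_assoc g.val.val, SLR.mul_inv_val, Matrix.one_mul]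
  · rw [Matrix.mul_assoc, ← h1, ← Matrix.mul_assoc, SLR.inv_mul_val, Matrix.one_mul]
  · nth_rewrite 2 [← h2]
    rw [← Matrix.mul_assoc, Matrix.mul_assoc _ h.val.val, SLR.mul_inv_val, Matrix.mul_one]
  · rw [← Matrix.mul_assoc, h2, Matrix.mul_assoc, SLR.inv_mul_val, Matrix.mul_one]

/-- The frame pair `(g Q, Q g⁻¹)` of a coset `g SL(m, ℝ)`, where `Q` is the projection onto the
last `n - m` coordinates. -/
def cosetPair (m n : ℕ) (q : ↥(SLR n) ⧸ SLRsub m n) :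
    Matrix (Fin n) (Fin n) ℝ × Matrix (Fin n) (Fin n) ℝ :=
  Quotient.liftOn' q
    (fun g => (g.val.val * diagonal (dvec m n), diagonal (dvec m n) * (g⁻¹).val.val))
    fun g h hgh => (cosetPair_wellDefined g h).mp (QuotientGroup.leftRel_apply.mp hgh)

theorem cosetPair_mk (g : ↥(SLR n)) :
    cosetPair m n (g : ↥(SLR n) ⧸ SLRsub m n) =
      (g.val.val * diagonal (dvec m n), diagonal (dvec m n) * (g⁻¹).val.val) :=
  rfl

theorem cosetPair_injective : Function.Injective (cosetPair m n) := by
  intro p q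
  induction p using QuotientGroup.induction_on
  induction q using QuotientGroup.induction_on
  exact fun h => QuotientGroup.eq.mpr ((cosetPair_wellDefined _ _).mpr h)

theorem continuous_cosetPair : Continuous (cosetPair m n) := by
  refine Continuous.quotient_liftOn' ?_ _
  have h : Continuous fun g : ↥(SLR n) => g.val.val :=
    Units.continuous_val.comp continuous_subtype_val
  exact (h.matrix_mul continuous_const).prodMk
    (continuous_const.matrix_mul (h.comp continuous_inv))

theorem isFramePair_cosetPair (q : ↥(SLR n) ⧸ SLRsub m n) :
    IsFramePair (diagonal (dvec m n)) (cosetPair m n q) := by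
  induction q using QuotientGroup.induction_on with | H g => ?_
  rw [cosetPair_mk]
  refine ⟨?_, ?_, ?_⟩
  · simp only
    rw [Matrix.mul_assoc, diagonal_dvec_mul_self]
  · simp only
    rw [← Matrix.mul_assoc, diagonal_dvec_mul_self]
  · simp only
    rw [Matrix.mul_assoc, ← Matrix.mul_assoc _ g.val.val, SLR.inv_mul_val, Matrix.one_mul,
      diagonal_dvec_mul_self]

/-- The inclusion of a subgroup of `SL(n, ℝ)` into the matrices. -/
def matrixHom (Γ : Subgroup ↥(SLR n)) : ↥Γ →* Matrix (Fin n) (Fin n) ℝ :=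
  (Units.coeHom _).comp ((SLR n).subtype.comp Γ.subtype)

theorem cosetPair_inv_smul (Γ : Subgroup ↥(SLR n)) (γ : ↥Γ) (q : ↥(SLR n) ⧸ SLRsub m n) :
    cosetPair m n (γ⁻¹ • q) = invTranslate (matrixHom Γ) γ (cosetPair m n q) := by
  induction q using QuotientGroup.induction_on with | H g => ?_
  have e : γ⁻¹ • (g : ↥(SLR n) ⧸ SLRsub m n) =
      (((γ⁻¹ : ↥Γ) : ↥(SLR n)) * g : ↥(SLR n)) := rfl
  have e' : (((γ⁻¹ : ↥Γ) : ↥(SLR n)) * g)⁻¹ = g⁻¹ * (γ : ↥(SLR n)) := by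
    simp [_root_.mul_inv_rev]
  rw [e, cosetPair_mk, cosetPair_mk, e']
  exact Prod.ext (Matrix.mul_assoc _ _ _) (Matrix.mul_assoc _ _ _).symm

/-- The inclusion of the special linear group into `SLR n`. -/
def toSLR (g : SpecialLinearGroup (Fin n) ℝ) : ↥(SLR n) :=
  ⟨SpecialLinearGroup.toGL g, g.det_coe⟩

theorem isCompact_setOf_entrySum_le (C : ℝ) :
    IsCompact {g : SpecialLinearGroup (Fin n) ℝ | entrySum g.val ≤ C} := by
  refine SpecialLinearGroup.isClosedEmbedding_val.isCompact_preimage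
    (K := {A : Matrix (Fin n) (Fin n) ℝ | entrySum A ≤ C}) ?_
  refine IsCompact.of_isClosed_subset
    (isCompact_univ_pi fun _ : Fin n => isCompact_univ_pi fun _ : Fin n =>
      isCompact_Icc (a := -C) (b := C))
    (isClosed_le continuous_entrySum continuous_const) fun A hA i _ j _ => ?_
  exact abs_le.mp ((abs_apply_le_entrySum A i j).trans hA)

theorem exists_isCompact_pairSize_le (hm : 0 < m) (hmn : m ≤ n) (S : ℝ) :
    ∃ K : Set (↥(SLR n) ⧸ SLRsub m n), IsCompact K ∧
      ∀ x, IsFramePair (diagonal (dvec m n)) x → pairSize x ≤ S →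
        ∃ q ∈ K, cosetPair m n q = x := by
  obtain ⟨C, hC⟩ := exists_det_eq_one_of_isFramePair hm hmn S
  have hcont : Continuous fun g : SpecialLinearGroup (Fin n) ℝ =>
      (toSLR g : ↥(SLR n) ⧸ SLRsub m n) :=
    continuous_quotient_mk'.comp (SpecialLinearGroup.continuous_toGL.subtype_mk _)
  refine ⟨_, (isCompact_setOf_entrySum_le C).image hcont, fun x hx hS => ?_⟩
  obtain ⟨g, hg, h1, h2, hgC⟩ := hC x hx hS
  refine ⟨_, ⟨⟨g, hg⟩, hgC, rfl⟩, ?_⟩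
  rw [cosetPair_mk]
  refine Prod.ext h1 ?_
  rw [← h2]
  have := SLR.mul_inv_val (toSLR ⟨g, hg⟩)
  calc x.2 * g * ((toSLR ⟨g, hg⟩)⁻¹).val.val
      = x.2 * ((toSLR ⟨g, hg⟩).val.val * ((toSLR ⟨g, hg⟩)⁻¹).val.val) :=
        Matrix.mul_assoc _ _ _
    _ = x.2 := by rw [this, Matrix.mul_one]

theorem exists_pairSize_bound (Γ : Subgroup ↥(SLR n))
    [CompactSpace (MulAction.orbitRel.Quotient ↥Γ (↥(SLR n) ⧸ SLRsub m n))] :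
    ∃ R : ℝ, ∀ q : ↥(SLR n) ⧸ SLRsub m n, ∃ γ : ↥Γ,
      pairSize (cosetPair m n (γ⁻¹ • q)) ≤ R := by
  let π : ↥(SLR n) ⧸ SLRsub m n →
      MulAction.orbitRel.Quotient ↥Γ (↥(SLR n) ⧸ SLRsub m n) := Quotient.mk _
  let U : ℕ → Set (↥(SLR n) ⧸ SLRsub m n) := fun k => {q | pairSize (cosetPair m n q) < k}
  have hU : ∀ k, IsOpen (U k) := fun k =>
    isOpen_lt (continuous_pairSize.comp continuous_cosetPair) continuous_const
  have hcont : ContinuousConstSMul ↥Γ (↥(SLR n) ⧸ SLRsub m n) :=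
    ⟨fun γ => continuous_const_smul (γ : ↥(SLR n))⟩
  have hmono : Monotone fun k => π '' U k := fun k l hkl =>
    Set.image_mono fun _ hq => lt_of_lt_of_le (Set.mem_ofPred.mp hq) (Nat.cast_le.mpr hkl)
  obtain ⟨k, hk⟩ := isCompact_univ.elim_directed_cover (fun k => π '' U k)
    (fun k => isOpenMap_quotient_mk'_mul _ (hU k))
    (fun y _ => by
      obtain ⟨q, rfl⟩ := Quotient.exists_rep y
      obtain ⟨k, hk⟩ := exists_nat_gt (pairSize (cosetPair m n q))
      exact Set.mem_iUnion.mpr ⟨k, q, hk, rfl⟩)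
    hmono.directed_le
  refine ⟨k, fun q => ?_⟩
  obtain ⟨p, hp, hpq⟩ := hk (Set.mem_univ (π q))
  obtain ⟨γ, hγ⟩ := MulAction.orbitRel_apply.mp (Quotient.exact hpq)
  refine ⟨γ⁻¹, ?_⟩
  rw [inv_inv]
  exact (show γ • q = p from hγ) ▸ le_of_lt hp

/-- A properly discontinuous cocompact action on `SL(n, ℝ) / SL(m, ℝ)`, read on frame pairs. -/
theorem nonempty_frameAction (hm : 0 < m) (hmn : m ≤ n) (Γ : Subgroup ↥(SLR n))
    [ProperlyDiscontinuousSMul ↥Γ (↥(SLR n) ⧸ SLRsub m n)]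
    [CompactSpace (MulAction.orbitRel.Quotient ↥Γ (↥(SLR n) ⧸ SLRsub m n))] :
    Nonempty (FrameAction ↥Γ (diagonal (dvec m n))) := by
  obtain ⟨R, hR⟩ := exists_pairSize_bound (m := m) Γ
  refine ⟨⟨matrixHom Γ, R, fun S => ?_, fun x hx => ?_⟩⟩
  · obtain ⟨K, hK, hKS⟩ := exists_isCompact_pairSize_le hm hmn S
    refine (ProperlyDiscontinuousSMul.finite_disjoint_inter_image (Γ := ↥Γ) hK hK).subset ?_
    rintro γ ⟨x, hx, hxS, hγS⟩
    obtain ⟨p, hp, rfl⟩ := hKS x hx hxS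
    rw [← cosetPair_inv_smul] at hγS
    obtain ⟨q, hq, hqp⟩ := hKS _ (isFramePair_cosetPair _) hγS
    have : q = γ⁻¹ • p := cosetPair_injective hqp
    refine ⟨p, ⟨q, hq, ?_⟩, hp⟩
    simp [this]
  · obtain ⟨K, -, hKS⟩ := exists_isCompact_pairSize_le hm hmn (pairSize x)
    obtain ⟨q, -, rfl⟩ := hKS x hx le_rfl
    obtain ⟨γ, hγ⟩ := hR q
    exact ⟨γ, cosetPair_inv_smul Γ γ q ▸ hγ⟩

end HomogeneousSpace

/-- **No compact Clifford–Klein forms for `SL(n,ℝ)/SL(m,ℝ)`, `m` even.**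
If `1 < m < n` and `m` is even, there is no discrete subgroup `Γ` of `G = SL(n,ℝ)` acting
properly discontinuously and cocompactly on the homogeneous space `G/H`,
where `H` is the standard block-diagonal copy of `SL(m,ℝ)`. -/
theorem no_compact_CliffordKlein_form_SL_SL (m n : ℕ) (h1m : 1 < m) (hmn : m < n)
    (heven : Even m) :
    ¬ ∃ Γ : Subgroup ↥(SLR n), DiscreteTopology ↥Γ ∧
      ProperlyDiscontinuousSMul ↥Γ (↥(SLR n) ⧸ SLRsub m n) ∧
      CompactSpace (MulAction.orbitRel.Quotient ↥Γ (↥(SLR n) ⧸ SLRsub m n)) := by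
  rintro ⟨Γ, -, hpd, hc⟩
  obtain ⟨F⟩ := nonempty_frameAction (by omega) hmn.le Γ
  rw [← diagonal_dvec_add_vecMulVec hmn] at F
  exact F.false_of_det_eq_neg_one (isFlag_diagonal_dvec hmn)
    (det_two_smul_diagonal_dvec_sub_one hmn heven) (exists_mem_ker_diagonal_dvec h1m hmn)
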